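/- arXiv:2507.04544 — 6 statements merged into one kernel-verified Lean document; each statement's English description precedes it below -/
import Mathlib

section
/- For every n ≥ 0, the Taylor polynomial satisfies T_n(1) = ∑_{k=0}^n b_k > √3/3. -/
open Finset

/-- Two power series with the same sum near `0` are equal. -/
lemma PowerSeries.eq_of_eventually_hasSum {P Q : PowerSeries ℂ} {f : ℂ → ℂ}
    (hP : ∀ᶠ z in nhds 0, HasSum (fun k => P.coeff k * z ^ k) (f z))
    (hQ : ∀ᶠ z in nhds 0, HasSum (fun k => Q.coeff k * z ^ k) (f z)) : P = Q := by
  have key : ∀ R : PowerSeries ℂ,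
      (∀ᶠ z in nhds 0, HasSum (fun k => R.coeff k * z ^ k) (f z)) →
        HasFPowerSeriesAt f (FormalMultilinearSeries.ofScalars ℂ fun k => R.coeff k) 0 := by
    intro R hR
    rw [hasFPowerSeriesAt_iff]
    filter_upwards [hR] with z hz
    simpa [FormalMultilinearSeries.coeff_ofScalars, mul_comm] using hz
  have h := (key P hP).eq_formalMultilinearSeries (key Q hQ)
  ext k
  simpa [FormalMultilinearSeries.coeff_ofScalars] using
    congrArg (fun p => FormalMultilinearSeries.coeff p k) h

/-- The sum of the product of two power series is the product of their sums. -/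
lemma PowerSeries.hasSum_coeff_mul {P Q : PowerSeries ℂ} {z s t : ℂ}
    (hP : HasSum (fun k => P.coeff k * z ^ k) s) (hQ : HasSum (fun k => Q.coeff k * z ^ k) t) :
    HasSum (fun k => (P * Q).coeff k * z ^ k) (s * t) := by
  have h := (summable_norm_sum_mul_antidiagonal_of_summable_norm hP.summable.norm
    hQ.summable.norm).of_norm.hasSum
  rw [← tsum_mul_tsum_eq_tsum_sum_antidiagonal_of_summable_norm hP.summable.norm
    hQ.summable.norm, hP.tsum_eq, hQ.tsum_eq] at h
  refine (congrArg (HasSum · (s * t)) (funext fun k => ?_)).mpr h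
  rw [PowerSeries.coeff_mul, Finset.sum_mul]
  refine Finset.sum_congr rfl fun p hp => ?_
  rw [← Finset.HasAntidiagonal.mem_antidiagonal.mp hp, pow_add]
  ring

lemma PowerSeries.hasSum_coeff_one_add_X_add_X_sq (z : ℂ) :
    HasSum (fun k => (1 + X + X ^ 2 : PowerSeries ℂ).coeff k * z ^ k) (1 + z + z ^ 2) := by
  have h := hasSum_sum_of_ne_finset_zero (L := .unconditional ℕ) (s := Finset.range 3)
    (f := fun k => (1 + X + X ^ 2 : PowerSeries ℂ).coeff k * z ^ k) fun k hk => by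
      rw [Finset.mem_range] at hk
      simp [coeff_one, coeff_X, coeff_X_pow, show k ≠ 0 by omega, show k ≠ 1 by omega,
        show k ≠ 2 by omega]
  simpa [Finset.sum_range_succ, coeff_one, coeff_X, coeff_X_pow] using h

/-- The coefficient recurrence given by the differential equation
`2 (1 + X + X²) B' = (1 + 2 X) B` of a square root `B` of `1 + X + X²`. -/
lemma PowerSeries.coeff_sqrt_one_add_X_add_X_sq {B : PowerSeries ℂ}
    (hB : B * B = 1 + X + X ^ 2) :
    2 * B.coeff 1 = B.coeff 0 ∧ ∀ n : ℕ,
      2 * ((n + 2) * B.coeff (n + 2) + (n + 1) * B.coeff (n + 1) + n * B.coeff n) =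
        B.coeff (n + 1) + 2 * B.coeff n := by
  have hd : B * derivative ℂ B + B * derivative ℂ B = 1 + 2 * X := by
    have h := congrArg (derivative ℂ) hB
    simpa [Derivation.leibniz, Derivation.leibniz_pow] using h
  have hode : (derivative ℂ B + X * derivative ℂ B + X * (X * derivative ℂ B)) +
      (derivative ℂ B + X * derivative ℂ B + X * (X * derivative ℂ B)) = B + X * B + X * B := by
    linear_combination B * hd - 2 * derivative ℂ B * hB
  constructor
  · have h := congrArg (coeff 0) hode
    simp only [map_add, coeff_zero_X_mul, coeff_derivative] at h
    push_cast at h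
    linear_combination h
  · intro n
    have h := congrArg (coeff (n + 1)) hode
    cases n with
    | zero =>
      simp only [map_add, coeff_succ_X_mul, coeff_zero_X_mul, coeff_derivative] at h
      push_cast at h ⊢
      linear_combination h
    | succ m =>
      simp only [map_add, coeff_succ_X_mul, coeff_derivative] at h
      push_cast at h ⊢
      linear_combination h

/-- The partial sums are convex combinations of the three preceding ones. -/
lemma sum_range_recurrence {b : ℕ → ℝ}
    (h : ∀ n : ℕ, 2 * ((n + 2) * b (n + 2) + (n + 1) * b (n + 1) + n * b n) =
      b (n + 1) + 2 * b n) (n : ℕ) :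
    (n + 3) * ∑ k ∈ range (n + 4), b k = n * ∑ k ∈ range (n + 1), b k +
      3 / 2 * (∑ k ∈ range (n + 3), b k + ∑ k ∈ range (n + 2), b k) := by
  induction n with
  | zero =>
    have h1 := h 0
    have h2 := h 1
    norm_num [Finset.sum_range_succ] at h1 h2 ⊢
    linarith
  | succ n ih =>
    have h1 := h (n + 1)
    have h2 := h (n + 2)
    simp only [Finset.sum_range_succ _ (n + 4), Finset.sum_range_succ _ (n + 3),
      Finset.sum_range_succ _ (n + 2), Finset.sum_range_succ _ (n + 1),
      show n + 1 + 1 = n + 2 from rfl, show n + 1 + 2 = n + 3 from rfl,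
      show n + 1 + 3 = n + 4 from rfl, show n + 1 + 4 = n + 5 from rfl] at ih h1 h2 ⊢
    push_cast at ih h1 h2 ⊢
    linear_combination ih + h2 / 2 - h1 / 2

lemma one_le_sum_range {b : ℕ → ℝ} (hb : b 0 = 1) (h₀ : 2 * b 1 = b 0)
    (h : ∀ n : ℕ, 2 * ((n + 2) * b (n + 2) + (n + 1) * b (n + 1) + n * b n) =
      b (n + 1) + 2 * b n) (n : ℕ) :
    1 ≤ ∑ k ∈ range (n + 1), b k := by
  induction n using Nat.strong_induction_on with
  | _ n ih =>
    match n with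
    | 0 => simp [hb]
    | 1 => norm_num [Finset.sum_range_succ]; linarith
    | 2 =>
      have h1 := h 0
      norm_num [Finset.sum_range_succ] at h1 ⊢
      linarith
    | n + 3 =>
      have i1 := ih n (by omega)
      have i2 := ih (n + 1) (by omega)
      have i3 := ih (n + 2) (by omega)
      have hr := sum_range_recurrence h n
      have hn : (0 : ℝ) ≤ n := n.cast_nonneg
      have hm := mul_le_mul_of_nonneg_left i1 hn
      refine le_of_mul_le_mul_left (a := (n : ℝ) + 3) ?_ (by positivity)
      change (n + 3 : ℝ) * 1 ≤ (n + 3) * ∑ k ∈ range (n + 4), b k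
      rw [hr]
      linarith

/-- Let `b_k` be the Taylor coefficients of the principal branch of
`√(1+z+z²)` and `T_n(z) = ∑_{k=0}^n b_k z^k`. Then `T_n(1) = ∑_{k=0}^n b_k > √3/3`
for every `n ≥ 0`. -/
theorem taylor_poly_at_one
    (b : ℕ → ℝ)
    (hb : ∀ᶠ z : ℂ in nhds 0,
      HasSum (fun k : ℕ => (b k : ℂ) * z ^ k) ((1 + z + z ^ 2) ^ ((1 : ℂ) / 2)))
    (n : ℕ) :
    Real.sqrt 3 / 3 < ∑ k ∈ Finset.range (n + 1), b k := by
  set B : PowerSeries ℂ := PowerSeries.mk fun k => (b k : ℂ) with hBdef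
  have hB : B * B = 1 + PowerSeries.X + PowerSeries.X ^ 2 := by
    refine PowerSeries.eq_of_eventually_hasSum ?_
      (.of_forall PowerSeries.hasSum_coeff_one_add_X_add_X_sq)
    filter_upwards [hb] with z hz
    have hz' : HasSum (fun k => B.coeff k * z ^ k) ((1 + z + z ^ 2) ^ ((1 : ℂ) / 2)) := by
      simpa [hBdef] using hz
    have hsq : ((1 + z + z ^ 2) ^ ((1 : ℂ) / 2)) * ((1 + z + z ^ 2) ^ ((1 : ℂ) / 2)) =
        1 + z + z ^ 2 := by
      rw [← sq, one_div]
      exact Complex.cpow_nat_inv_pow _ two_ne_zero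
    simpa only [hsq] using PowerSeries.hasSum_coeff_mul hz' hz'
  obtain ⟨h₀, h⟩ := PowerSeries.coeff_sqrt_one_add_X_add_X_sq hB
  simp only [hBdef, PowerSeries.coeff_mk] at h₀ h
  have hb0 : b 0 = 1 := by
    have h1 := hb.self_of_nhds.unique (hasSum_single 0 fun k hk => by simp [hk])
    simpa using h1.symm
  have hsum := one_le_sum_range hb0 (by exact_mod_cast h₀) (fun m => by exact_mod_cast h m) n
  have h3 : Real.sqrt 3 < 3 := by
    rw [Real.sqrt_lt' (by norm_num)]
    norm_num
  linarith
end

section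
/- The series of every third coefficient converges with ∑_{k=0}^∞ b_{3k} = √3/3. -/
open Finset

theorem sum_range_catalan_div_four_pow (n : ℕ) :
    ∑ k ∈ range n, (catalan k : ℝ) / 4 ^ k = 2 - 2 * (n.centralBinom : ℝ) / 4 ^ n := by
  induction n with
  | zero => simp
  | succ n ih =>
    have hcat : ((n : ℝ) + 1) * catalan n = n.centralBinom := by
      exact_mod_cast succ_mul_catalan_eq_centralBinom n
    have hsucc : ((n : ℝ) + 1) * (n + 1).centralBinom = 2 * (2 * n + 1) * n.centralBinom := by
      exact_mod_cast Nat.succ_mul_centralBinom_succ n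
    have hne : (n : ℝ) + 1 ≠ 0 := by positivity
    have hval : ((n + 1).centralBinom : ℝ) = 2 * (2 * n + 1) * catalan n := by
      apply mul_left_cancel₀ hne
      rw [hsucc, ← hcat]
      ring
    rw [sum_range_succ, ih, hval, ← hcat, pow_succ]
    field_simp
    ring

theorem summable_catalan_div_four_pow : Summable fun k : ℕ => (catalan k : ℝ) / 4 ^ k := by
  refine summable_of_sum_range_le (c := 2) (fun k => by positivity) fun n => ?_
  rw [sum_range_catalan_div_four_pow]
  have : 0 ≤ 2 * (n.centralBinom : ℝ) / 4 ^ n := by positivity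
  linarith

theorem summable_norm_catalan_mul_pow {x : ℂ} (hx : ‖x‖ ≤ 1) :
    Summable fun k : ℕ => ‖(catalan k : ℂ) * (x / 4) ^ k‖ := by
  refine summable_catalan_div_four_pow.of_nonneg_of_le (fun k => norm_nonneg _) fun k => ?_
  rw [norm_mul, norm_pow, norm_div, Complex.norm_natCast, div_pow, Complex.norm_ofNat]
  rw [mul_div_assoc']
  gcongr
  exact mul_le_of_le_one_right (by positivity) (pow_le_one₀ (norm_nonneg _) hx)

theorem tsum_catalan_mul_pow_eq {x : ℂ} (hx : ‖x‖ ≤ 1) :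
    ∑' k : ℕ, (catalan k : ℂ) * (x / 4) ^ k =
      1 + x / 4 * (∑' k : ℕ, (catalan k : ℂ) * (x / 4) ^ k) ^ 2 := by
  have hs := summable_norm_catalan_mul_pow hx
  rw [sq, tsum_mul_tsum_eq_tsum_sum_antidiagonal_of_summable_norm hs hs,
    hs.of_norm.tsum_eq_zero_add, ← tsum_mul_left]
  congr 1
  · simp
  · refine tsum_congr fun n => ?_
    rw [catalan_succ', Nat.cast_sum, sum_mul, mul_sum]
    refine sum_congr rfl fun p hp => ?_
    rw [← mem_antidiagonal.mp hp]
    push_cast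
    ring

/-- The Taylor coefficients at `0` of `√(1 - x)`. -/
noncomputable def sqrtOneSubCoeff : ℕ → ℝ
  | 0 => 1
  | k + 1 => -(catalan k / (2 * 4 ^ k))

/-- The sum of the Taylor series at `0` of `√(1 - x)`. -/
noncomputable def sqrtOneSub (x : ℂ) : ℂ := ∑' k : ℕ, (sqrtOneSubCoeff k : ℂ) * x ^ k

theorem sqrtOneSubCoeff_succ_mul_pow (x : ℂ) (k : ℕ) :
    (sqrtOneSubCoeff (k + 1) : ℂ) * x ^ (k + 1) = -(x / 2) * (catalan k * (x / 4) ^ k) := by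
  simp only [sqrtOneSubCoeff]
  push_cast
  rw [div_pow]
  ring

theorem summable_norm_sqrtOneSubCoeff_mul_pow {x : ℂ} (hx : ‖x‖ ≤ 1) :
    Summable fun k : ℕ => ‖(sqrtOneSubCoeff k : ℂ) * x ^ k‖ := by
  rw [← summable_nat_add_iff 1]
  simp only [sqrtOneSubCoeff_succ_mul_pow, norm_mul (-(x / 2))]
  exact (summable_norm_catalan_mul_pow hx).mul_left _

theorem sqrtOneSub_sq {x : ℂ} (hx : ‖x‖ ≤ 1) : sqrtOneSub x ^ 2 = 1 - x := by
  have h := tsum_catalan_mul_pow_eq hx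
  rw [sqrtOneSub, (summable_norm_sqrtOneSubCoeff_mul_pow hx).of_norm.tsum_eq_zero_add]
  simp only [sqrtOneSubCoeff_succ_mul_pow]
  rw [tsum_mul_left]
  simp only [sqrtOneSubCoeff, Complex.ofReal_one, pow_zero, mul_one]
  linear_combination (-x) * h

theorem sqrtOneSub_zero : sqrtOneSub 0 = 1 := by
  rw [sqrtOneSub, tsum_eq_single 0 fun k hk => by simp [hk]]
  simp [sqrtOneSubCoeff]

theorem sqrtOneSub_one : sqrtOneSub 1 = 0 := by
  have h := sqrtOneSub_sq (x := 1) (by simp)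
  rwa [sub_self, sq_eq_zero_iff] at h

theorem sqrtOneSub_conj (x : ℂ) :
    sqrtOneSub (starRingEnd ℂ x) = starRingEnd ℂ (sqrtOneSub x) := by
  simp only [sqrtOneSub, Complex.conj_tsum, map_mul, map_pow, Complex.conj_ofReal]

/-- The Taylor coefficients at `0` of `√(1 - u z) * √(1 - v z)`. -/
noncomputable def sqrtOneSubMulCoeff (u v : ℂ) (n : ℕ) : ℂ :=
  ∑ p ∈ antidiagonal n, (sqrtOneSubCoeff p.1 * u ^ p.1) * (sqrtOneSubCoeff p.2 * v ^ p.2)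

theorem hasSum_sqrtOneSubMulCoeff {u v z : ℂ} (hu : ‖u‖ ≤ 1) (hv : ‖v‖ ≤ 1) (hz : ‖z‖ ≤ 1) :
    HasSum (fun n => sqrtOneSubMulCoeff u v n * z ^ n)
      (sqrtOneSub (u * z) * sqrtOneSub (v * z)) := by
  have hsu := summable_norm_sqrtOneSubCoeff_mul_pow (x := u * z)
    (by rw [norm_mul]; exact mul_le_one₀ hu (norm_nonneg _) hz)
  have hsv := summable_norm_sqrtOneSubCoeff_mul_pow (x := v * z)
    (by rw [norm_mul]; exact mul_le_one₀ hv (norm_nonneg _) hz)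
  have hs := (summable_norm_sum_mul_antidiagonal_of_summable_norm hsu hsv).of_norm.hasSum
  rw [← tsum_mul_tsum_eq_tsum_sum_antidiagonal_of_summable_norm hsu hsv] at hs
  refine hs.congr_fun fun n => ?_
  rw [sqrtOneSubMulCoeff, sum_mul]
  refine sum_congr rfl fun p hp => ?_
  rw [← mem_antidiagonal.mp hp]
  ring

theorem hasFPowerSeriesAt_zero_of_eventually_hasSum {a : ℕ → ℂ} {f : ℂ → ℂ}
    (h : ∀ᶠ z in nhds 0, HasSum (fun n => a n * z ^ n) (f z)) :
    HasFPowerSeriesAt f (FormalMultilinearSeries.ofScalars ℂ a) 0 := by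
  rw [hasFPowerSeriesAt_iff]
  filter_upwards [h] with z hz
  simpa [FormalMultilinearSeries.coeff_ofScalars, mul_comm] using hz

theorem eq_of_eventually_hasSum {a a' : ℕ → ℂ} {f : ℂ → ℂ}
    (h : ∀ᶠ z in nhds 0, HasSum (fun n => a n * z ^ n) (f z))
    (h' : ∀ᶠ z in nhds 0, HasSum (fun n => a' n * z ^ n) (f z)) : a = a' := by
  have heq := (hasFPowerSeriesAt_zero_of_eventually_hasSum h).eq_formalMultilinearSeries
    (hasFPowerSeriesAt_zero_of_eventually_hasSum h')
  funext n
  simpa [FormalMultilinearSeries.coeff_ofScalars] using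
    congrArg (fun p => FormalMultilinearSeries.coeff p n) heq

theorem eventually_norm_le_one : ∀ᶠ z : ℂ in nhds 0, ‖z‖ ≤ 1 := by
  filter_upwards [Metric.closedBall_mem_nhds (0 : ℂ) one_pos] with z hz
  simpa using hz

theorem eventually_sqrtOneSub_mul_eq_cpow {u v : ℂ} (hu : ‖u‖ ≤ 1) (hv : ‖v‖ ≤ 1) :
    ∀ᶠ z in nhds (0 : ℂ), sqrtOneSub (u * z) * sqrtOneSub (v * z) =
      ((1 - u * z) * (1 - v * z)) ^ ((1 : ℂ) / 2) := by
  have hcont : ContinuousAt (fun z => sqrtOneSub (u * z) * sqrtOneSub (v * z)) 0 :=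
    (hasFPowerSeriesAt_zero_of_eventually_hasSum (eventually_norm_le_one.mono fun z hz =>
      hasSum_sqrtOneSubMulCoeff hu hv hz)).continuousAt
  have hre : ∀ᶠ z in nhds (0 : ℂ), 0 < (sqrtOneSub (u * z) * sqrtOneSub (v * z)).re :=
    (Complex.continuous_re.continuousAt.comp hcont).eventually_const_lt
      (by simp [sqrtOneSub_zero])
  filter_upwards [eventually_norm_le_one, hre] with z hz hpos
  rw [← sqrtOneSub_sq (x := u * z) (by rw [norm_mul]; exact mul_le_one₀ hu (norm_nonneg _) hz),
    ← sqrtOneSub_sq (x := v * z) (by rw [norm_mul]; exact mul_le_one₀ hv (norm_nonneg _) hz),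
    ← mul_pow, one_div, Complex.sq_cpow_two_inv hpos]

theorem one_add_pow_add_pow_eq_ite {ω : ℂ} (hω : 1 + ω + ω ^ 2 = 0) (k : ℕ) :
    1 + ω ^ k + (ω ^ 2) ^ k = if 3 ∣ k then 3 else 0 := by
  have h3 : ω ^ 3 = 1 := by linear_combination (ω - 1) * hω
  have hmod : ω ^ k = ω ^ (k % 3) := pow_eq_pow_mod k h3
  rw [← pow_mul, mul_comm, pow_mul, hmod]
  have hlt : k % 3 < 3 := Nat.mod_lt _ (by norm_num)
  simp only [Nat.dvd_iff_mod_eq_zero]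
  interval_cases k % 3
  · norm_num
  · simpa using hω
  · simp only [OfNat.ofNat_ne_zero, if_false]
    linear_combination hω + ω * h3

theorem hasSum_three_mul {a : ℕ → ℂ} {ω s₀ s₁ s₂ : ℂ} (hω : 1 + ω + ω ^ 2 = 0)
    (h₀ : HasSum a s₀) (h₁ : HasSum (fun k => a k * ω ^ k) s₁)
    (h₂ : HasSum (fun k => a k * (ω ^ 2) ^ k) s₂) :
    HasSum (fun k => a (3 * k)) ((s₀ + s₁ + s₂) / 3) := by
  have hinj : Function.Injective fun k : ℕ => 3 * k := fun i j h => by simpa using h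
  have hsum : HasSum (fun k => if 3 ∣ k then a k else 0) ((s₀ + s₁ + s₂) / 3) := by
    refine (((h₀.add h₁).add h₂).div_const 3).congr_fun fun k => ?_
    have hk := one_add_pow_add_pow_eq_ite hω k
    split_ifs at hk ⊢ <;> linear_combination (-a k / 3) * hk
  rw [← hinj.hasSum_iff] at hsum
  · simpa [Function.comp_def] using hsum
  · intro k hk
    exact if_neg fun ⟨j, hj⟩ => hk ⟨j, hj.symm⟩

theorem sqrtOneSub_mul_conj_eq_sqrt_three {ω : ℂ} (hω : 1 + ω + ω ^ 2 = 0) (hnorm : ‖ω‖ = 1)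
    (hconj : starRingEnd ℂ ω = ω ^ 2) :
    sqrtOneSub ω * sqrtOneSub (ω ^ 2) = (Real.sqrt 3 : ℝ) := by
  have hsq : (sqrtOneSub ω * sqrtOneSub (ω ^ 2)) ^ 2 = 3 := by
    rw [mul_pow, sqrtOneSub_sq hnorm.le, sqrtOneSub_sq (by simp [hnorm])]
    linear_combination (ω - 2) * hω
  rw [← hconj, sqrtOneSub_conj, Complex.mul_conj] at hsq ⊢
  norm_cast at hsq ⊢
  rw [← hsq, Real.sqrt_sq (Complex.normSq_nonneg _)]

/-- Let `b_k` be the Taylor coefficients of the principal branch of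
`√(1+z+z²)`. The series of every third coefficient converges with
`∑_{k=0}^∞ b_{3k} = √3/3`. -/
theorem every_third_coeff_sum
    (b : ℕ → ℝ)
    (hb : ∀ᶠ z : ℂ in nhds 0,
      HasSum (fun k : ℕ => (b k : ℂ) * z ^ k) ((1 + z + z ^ 2) ^ ((1 : ℂ) / 2))) :
    HasSum (fun k : ℕ => b (3 * k)) (Real.sqrt 3 / 3) := by
  obtain ⟨ω, hprim⟩ : ∃ ω : ℂ, IsPrimitiveRoot ω 3 :=
    ⟨_, Complex.isPrimitiveRoot_exp 3 (by norm_num)⟩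
  have hω : 1 + ω + ω ^ 2 = 0 := by
    simpa [sum_range_succ] using hprim.geom_sum_eq_zero (by norm_num)
  have h3 : ω ^ 3 = 1 := hprim.pow_eq_one
  have hnorm : ‖ω‖ = 1 := hprim.norm'_eq_one (by norm_num)
  have hnorm2 : ‖ω ^ 2‖ = 1 := by simp [hnorm]
  have hconj : starRingEnd ℂ ω = ω ^ 2 := by
    have h : ω * starRingEnd ℂ ω = 1 := by simp [Complex.mul_conj', hnorm]
    linear_combination ω ^ 2 * h - starRingEnd ℂ ω * h3
  have hcoeff : (fun k => (b k : ℂ)) = sqrtOneSubMulCoeff ω (ω ^ 2) := by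
    refine eq_of_eventually_hasSum hb ?_
    filter_upwards [eventually_norm_le_one,
      eventually_sqrtOneSub_mul_eq_cpow hnorm.le hnorm2.le] with z hz hcpow
    have hfac : 1 + z + z ^ 2 = (1 - ω * z) * (1 - ω ^ 2 * z) := by
      linear_combination z * hω - z ^ 2 * h3
    rw [hfac, ← hcpow]
    exact hasSum_sqrtOneSubMulCoeff hnorm.le hnorm2.le hz
  have hsum {z : ℂ} (hz : ‖z‖ ≤ 1) : HasSum (fun k => (b k : ℂ) * z ^ k)
      (sqrtOneSub (ω * z) * sqrtOneSub (ω ^ 2 * z)) := by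
    simpa only [← hcoeff] using hasSum_sqrtOneSubMulCoeff hnorm.le hnorm2.le hz
  have h₀ : HasSum (fun k => (b k : ℂ)) (Real.sqrt 3 : ℝ) := by
    simpa [sqrtOneSub_mul_conj_eq_sqrt_three hω hnorm hconj] using hsum (z := 1) (by simp)
  have h₁ : HasSum (fun k => (b k : ℂ) * ω ^ k) 0 := by
    simpa [← pow_succ, h3, sqrtOneSub_one] using hsum hnorm.le
  have h₂ : HasSum (fun k => (b k : ℂ) * (ω ^ 2) ^ k) 0 := by
    simpa only [← pow_succ', h3, sqrtOneSub_one, zero_mul] using hsum hnorm2.le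
  rw [← Complex.hasSum_ofReal]
  simpa using hasSum_three_mul hω h₀ h₁ h₂
end

section
/- The Taylor coefficients of √(1+z+z²) are absolutely summable: ∑_{k=0}^∞ |b_k| < ∞. Consequently, the Taylor polynomials T_n(z) = ∑_{k=0}^n b_k z^k converge uniformly on the closed unit disk to the continuous extension of √(1+z+z²). -/
open Finset Metric

/-- The absorption identity for generalized binomial coefficients. -/
theorem succ_mul_ringChoose_succ (a : ℝ) (k : ℕ) :
    (k + 1 : ℝ) * Ring.choose a (k + 1) = (a - k) * Ring.choose a k := by
  have hk : ((k.factorial : ℕ) : ℝ) ≠ 0 := by positivity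
  rw [Ring.choose_eq_smul, Ring.choose_eq_smul, descPochhammer_succ_right, Nat.factorial_succ]
  simp only [Polynomial.smeval_mul, Polynomial.smeval_sub, Polynomial.smeval_X,
    Polynomial.smeval_natCast, smul_eq_mul]
  push_cast
  field_simp
  simp

/-- The binomial series with exponent `a ∈ (0, 1]` has absolutely summable coefficients. -/
theorem summable_abs_ringChoose {a : ℝ} (ha : 0 < a) (ha1 : a ≤ 1) :
    Summable fun k : ℕ => |Ring.choose a k| := by
  have key (k : ℕ) : a * |Ring.choose a (k + 1)| =
      (k + 1) * |Ring.choose a (k + 1)| - (k + 2) * |Ring.choose a (k + 2)| := by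
    have h := congrArg abs (succ_mul_ringChoose_succ a (k + 1))
    rw [abs_mul, abs_mul] at h
    push_cast at h
    rw [abs_of_pos (by positivity : (0 : ℝ) < k + 1 + 1),
      abs_of_nonpos (by linarith [(k.cast_nonneg : (0 : ℝ) ≤ k)] : a - (k + 1) ≤ 0)] at h
    linear_combination h
  have hsum (n : ℕ) : a * ∑ k ∈ Finset.range n, |Ring.choose a (k + 1)| =
      |Ring.choose a 1| - (n + 1) * |Ring.choose a (n + 1)| := by
    induction n with
    | zero => simp
    | succ n ih =>
      rw [Finset.sum_range_succ, mul_add, ih, key]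
      push_cast
      ring
  rw [← summable_nat_add_iff 1]
  refine summable_of_sum_range_le (c := |Ring.choose a 1| / a) (fun _ => abs_nonneg _) fun n => ?_
  rw [le_div_iff₀ ha, mul_comm, hsum]
  have : 0 ≤ (n + 1 : ℝ) * |Ring.choose a (n + 1)| := by positivity
  linarith

/-- The binomial series converges to `(1 + w) ^ a` in the unit disk. -/
theorem hasSum_one_add_cpow (a : ℂ) {w : ℂ} (hw : ‖w‖ < 1) :
    HasSum (fun k : ℕ => Ring.choose a k * w ^ k) ((1 + w) ^ a) := by
  have h := (Complex.one_add_cpow_hasFPowerSeriesOnBall_zero (a := a)).hasSum (y := w)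
    (by simpa [enorm_eq_nnnorm, ← NNReal.coe_lt_coe] using hw)
  simpa [binomialSeries, FormalMultilinearSeries.coeff_ofScalars, mul_comm] using h

/-- Power series with the same sum near `0` have the same coefficients. -/
theorem coeff_eq_of_eventually_hasSum {f : ℂ → ℂ} {b c : ℕ → ℂ}
    (hb : ∀ᶠ z in nhds 0, HasSum (fun k => b k * z ^ k) (f z))
    (hc : ∀ᶠ z in nhds 0, HasSum (fun k => c k * z ^ k) (f z)) : b = c := by
  have aux (d : ℕ → ℂ) (hd : ∀ᶠ z in nhds 0, HasSum (fun k => d k * z ^ k) (f z)) :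
      HasFPowerSeriesAt f (FormalMultilinearSeries.ofScalars ℂ d) 0 := by
    rw [hasFPowerSeriesAt_iff]
    filter_upwards [hd] with z hz
    simpa [FormalMultilinearSeries.coeff_ofScalars, mul_comm] using hz
  have h := (aux b hb).eq_formalMultilinearSeries (aux c hc)
  ext k
  simpa [FormalMultilinearSeries.coeff_ofScalars] using
    congrArg (FormalMultilinearSeries.coeff · k) h

/-- Complex powers are multiplicative on the right half-plane. -/
theorem mul_cpow_of_re_pos {u v : ℂ} (hu : 0 < u.re) (hv : 0 < v.re) (s : ℂ) :
    (u * v) ^ s = u ^ s * v ^ s := by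
  have hu0 : u ≠ 0 := by rintro rfl; simp at hu
  have hv0 : v ≠ 0 := by rintro rfl; simp at hv
  have hau := abs_lt.1 (Complex.abs_arg_lt_pi_div_two_iff.2 (Or.inl hu))
  have hav := abs_lt.1 (Complex.abs_arg_lt_pi_div_two_iff.2 (Or.inl hv))
  rw [Complex.cpow_def_of_ne_zero (mul_ne_zero hu0 hv0), Complex.cpow_def_of_ne_zero hu0,
    Complex.cpow_def_of_ne_zero hv0, ← Complex.exp_add, ← add_mul,
    Complex.log_mul hu0 hv0 ⟨by linarith, by linarith⟩]

/-- `(1 + w) ^ a` with `a ∈ (0, 1]` has absolutely summable Taylor coefficients. -/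
theorem exists_summable_hasSum_one_add_cpow {a : ℝ} (ha : 0 < a) (ha1 : a ≤ 1) :
    ∃ r : ℕ → ℂ, (Summable fun k => ‖r k‖) ∧ ∀ w : ℂ, ‖w‖ < 1 →
      HasSum (fun k => r k * w ^ k) ((1 + w) ^ (a : ℂ)) := by
  refine ⟨fun k => Ring.choose (a : ℂ) k, ?_, fun w hw => hasSum_one_add_cpow a hw⟩
  simpa [← Complex.ofReal_choose] using summable_abs_ringChoose ha ha1

/-- The Cauchy product of two power series that converge absolutely at `z`. -/
theorem hasSum_cauchyProduct {c d : ℕ → ℂ} {z A B : ℂ}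
    (hA : HasSum (fun k => c k * z ^ k) A) (hB : HasSum (fun k => d k * z ^ k) B) :
    HasSum (fun n => (∑ kl ∈ antidiagonal n, c kl.1 * d kl.2) * z ^ n) (A * B) := by
  have h := (summable_norm_sum_mul_antidiagonal_of_summable_norm
    hA.summable.norm hB.summable.norm).of_norm.hasSum
  rw [← tsum_mul_tsum_eq_tsum_sum_antidiagonal_of_summable_norm
    hA.summable.norm hB.summable.norm, hA.tsum_eq, hB.tsum_eq] at h
  refine h.congr_fun fun n => ?_
  rw [Finset.sum_mul]
  refine Finset.sum_congr rfl fun kl hkl => ?_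
  rw [← Finset.HasAntidiagonal.mem_antidiagonal.1 hkl]
  ring

/-- The unit disk around `1` lies in the right half-plane. -/
theorem re_one_add_pos {w : ℂ} (hw : ‖w‖ < 1) : 0 < (1 + w).re := by
  have h := (abs_lt.1 ((Complex.abs_re_le_norm w).trans_lt hw)).1
  rw [Complex.add_re, Complex.one_re]
  linarith

/-- If `α` and `β` lie on the unit circle, the Taylor coefficients of
`((1 + α z) (1 + β z)) ^ a` are absolutely summable for `a ∈ (0, 1]`. -/
theorem exists_summable_hasSum_mul_cpow {a : ℝ} (ha : 0 < a) (ha1 : a ≤ 1) {α β : ℂ}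
    (hα : ‖α‖ = 1) (hβ : ‖β‖ = 1) :
    ∃ c : ℕ → ℂ, (Summable fun k => ‖c k‖) ∧ ∀ z ∈ ball (0 : ℂ) 1,
      HasSum (fun k => c k * z ^ k) (((1 + α * z) * (1 + β * z)) ^ (a : ℂ)) := by
  obtain ⟨r, hr, hrsum⟩ := exists_summable_hasSum_one_add_cpow ha ha1
  have hs (γ : ℂ) (hγ : ‖γ‖ = 1) : Summable fun k => ‖r k * γ ^ k‖ := by
    simpa [hγ] using hr
  refine ⟨_, summable_norm_sum_mul_antidiagonal_of_summable_norm (hs α hα) (hs β hβ),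
    fun z hz => ?_⟩
  have hlt (γ : ℂ) (hγ : ‖γ‖ = 1) : ‖γ * z‖ < 1 := by
    rw [norm_mul, hγ, one_mul]
    exact mem_ball_zero_iff.1 hz
  have hsum (γ : ℂ) (hγ : ‖γ‖ = 1) : HasSum (fun k => r k * γ ^ k * z ^ k)
      ((1 + γ * z) ^ (a : ℂ)) := by
    simpa only [mul_pow, mul_assoc] using hrsum (γ * z) (hlt γ hγ)
  rw [mul_cpow_of_re_pos (re_one_add_pos (hlt α hα)) (re_one_add_pos (hlt β hβ))]
  exact hasSum_cauchyProduct (c := fun k => r k * α ^ k) (d := fun k => r k * β ^ k)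
    (hsum α hα) (hsum β hβ)

/-- `1 + z + z²` splits into linear factors with roots on the unit circle. -/
theorem exists_one_add_add_sq_eq_mul :
    ∃ α β : ℂ, ‖α‖ = 1 ∧ ‖β‖ = 1 ∧ ∀ z : ℂ, 1 + z + z ^ 2 = (1 + α * z) * (1 + β * z) := by
  have h3 : ((√3 : ℝ) : ℂ) ^ 2 = 3 := by
    rw [← Complex.ofReal_pow, Real.sq_sqrt (by norm_num)]
    norm_num
  have hnorm (t : ℝ) (ht : t ^ 2 = 3) :
      ‖((1 / 2 : ℝ) : ℂ) + ((t / 2 : ℝ) : ℂ) * Complex.I‖ = 1 := by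
    rw [Complex.norm_add_mul_I, div_pow t, ht]
    norm_num
  refine ⟨_, _, hnorm (√3) (by norm_num), hnorm (-√3) (by norm_num), fun z => ?_⟩
  push_cast
  linear_combination (z ^ 2 / 4 * ((√3 : ℝ) : ℂ) ^ 2) * Complex.I_sq - z ^ 2 / 4 * h3

/-- Let `b_k` be the Taylor coefficients of the principal branch of
`√(1+z+z²)`. Then `∑_{k=0}^∞ |b_k| < ∞`, and the Taylor polynomials
`T_n(z) = ∑_{k=0}^n b_k z^k` converge uniformly on the closed unit disk to the
continuous extension of `√(1+z+z²)`. -/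
theorem coeff_abs_summable_and_uniform_convergence
    (b : ℕ → ℝ)
    (hb : ∀ᶠ z : ℂ in nhds 0,
      HasSum (fun k : ℕ => (b k : ℂ) * z ^ k) ((1 + z + z ^ 2) ^ ((1 : ℂ) / 2))) :
    Summable (fun k : ℕ => |b k|) ∧
    ∃ g : ℂ → ℂ, ContinuousOn g (closedBall (0 : ℂ) 1) ∧
      (∀ z ∈ ball (0 : ℂ) 1, g z = (1 + z + z ^ 2) ^ ((1 : ℂ) / 2)) ∧
      TendstoUniformlyOn
        (fun (n : ℕ) (z : ℂ) => ∑ k ∈ Finset.range (n + 1), (b k : ℂ) * z ^ k)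
        g Filter.atTop (closedBall (0 : ℂ) 1) := by
  obtain ⟨α, β, hα, hβ, hfac⟩ := exists_one_add_add_sq_eq_mul
  obtain ⟨c, hc, hsum⟩ :=
    exists_summable_hasSum_mul_cpow (a := 1 / 2) (by norm_num) (by norm_num) hα hβ
  have hsum' : ∀ z ∈ ball (0 : ℂ) 1,
      HasSum (fun k => c k * z ^ k) ((1 + z + z ^ 2) ^ ((1 : ℂ) / 2)) := fun z hz => by
    simpa [hfac z] using hsum z hz
  obtain rfl : (fun k => (b k : ℂ)) = c := coeff_eq_of_eventually_hasSum hb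
    (Filter.eventually_of_mem (ball_mem_nhds 0 one_pos) hsum')
  have hb' : Summable fun k : ℕ => |b k| := by simpa using hc
  have hbound : ∀ (k : ℕ) (z : ℂ), z ∈ closedBall (0 : ℂ) 1 → ‖(b k : ℂ) * z ^ k‖ ≤ |b k| := by
    intro k z hz
    rw [norm_mul, norm_pow, Complex.norm_real, Real.norm_eq_abs]
    exact mul_le_of_le_one_right (abs_nonneg _)
      (pow_le_one₀ (norm_nonneg _) (mem_closedBall_zero_iff.1 hz))
  refine ⟨hb', fun z => ∑' k, (b k : ℂ) * z ^ k,
    continuousOn_tsum (fun k => by fun_prop) hb' hbound, fun z hz => (hsum' z hz).tsum_eq, ?_⟩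
  intro v hv
  exact (Filter.tendsto_add_atTop_nat 1).eventually (tendstoUniformlyOn_tsum_nat hb' hbound v hv)
end

section
/- Fix n ≥ 1 divisible by 3 and let γ_k denote the Taylor coefficients at 0 of T_n(z)√(1−z). Then γ_{n+1} = −b_{n+1}; in particular γ_{n+1} < 0. -/
open Finset

open PowerSeries Topology

/-- The real formal power series `p` converges to `f` on a neighbourhood of `0` in `ℂ`. -/
def HasRealTaylor (p : PowerSeries ℝ) (f : ℂ → ℂ) : Prop :=
  ∀ᶠ z : ℂ in 𝓝 0, HasSum (fun k : ℕ => ((coeff k p : ℝ) : ℂ) * z ^ k) (f z)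

namespace HasRealTaylor

variable {p q : PowerSeries ℝ} {f g : ℂ → ℂ}

theorem congr (hp : HasRealTaylor p f) (hfg : ∀ z, f z = g z) : HasRealTaylor p g := by
  rwa [← funext hfg]

theorem mul (hp : HasRealTaylor p f) (hq : HasRealTaylor q g) :
    HasRealTaylor (p * q) (fun z => f z * g z) := by
  filter_upwards [hp, hq] with z hf hg
  have h := hasSum_sum_range_mul_of_summable_norm hf.summable.norm hg.summable.norm
  rw [hf.tsum_eq, hg.tsum_eq] at h
  refine h.congr_fun fun n => ?_
  rw [coeff_mul, Nat.sum_antidiagonal_eq_sum_range_succ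
    (fun i j => coeff i p * coeff j q), Complex.ofReal_sum, Finset.sum_mul]
  refine Finset.sum_congr rfl fun k hk => ?_
  rw [← Nat.add_sub_of_le (Nat.lt_succ_iff.mp (Finset.mem_range.mp hk)), pow_add,
    Nat.add_sub_cancel_left]
  push_cast
  ring

theorem unique (hp : HasRealTaylor p f) (hq : HasRealTaylor q f) : p = q := by
  have key : ∀ {r : PowerSeries ℝ}, HasRealTaylor r f →
      HasFPowerSeriesAt f
        (FormalMultilinearSeries.ofScalars ℂ fun k => ((coeff k r : ℝ) : ℂ)) 0 := by
    intro r hr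
    rw [hasFPowerSeriesAt_iff]
    filter_upwards [hr] with z hz
    simpa [FormalMultilinearSeries.coeff_ofScalars, mul_comm] using hz
  have h := (key hp).eq_formalMultilinearSeries (key hq)
  ext k
  have hk := congrArg (fun s => FormalMultilinearSeries.coeff s k) h
  simpa [FormalMultilinearSeries.coeff_ofScalars] using hk

theorem constantCoeff_eq (hp : HasRealTaylor p f) : ((constantCoeff p : ℝ) : ℂ) = f 0 := by
  have h := hp.self_of_nhds
  refine HasSum.unique ?_ h
  convert hasSum_single (f := fun k : ℕ => ((coeff k p : ℝ) : ℂ) * 0 ^ k) 0 ?_ using 1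
  · simp
  · intro k hk
    simp [hk]

theorem of_polynomial (P : Polynomial ℝ) :
    HasRealTaylor (P : PowerSeries ℝ) (fun z => Polynomial.aeval z P) := by
  refine Filter.Eventually.of_forall fun z => ?_
  beta_reduce
  rw [Polynomial.aeval_eq_sum_range]
  convert hasSum_sum_of_ne_finset_zero
    (f := fun k : ℕ => ((coeff k (P : PowerSeries ℝ) : ℝ) : ℂ) * z ^ k)
    (s := Finset.range (P.natDegree + 1)) ?_ using 1
  · simp
  · intro k hk
    simp only [Finset.mem_range, not_lt] at hk
    simp [Polynomial.coeff_eq_zero_of_natDegree_lt (Nat.lt_of_succ_le hk)]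
  · infer_instance

end HasRealTaylor

theorem PowerSeries.eq_of_sq_eq_sq {p q : PowerSeries ℝ} (h : p ^ 2 = q ^ 2)
    (hp : constantCoeff p = 1) (hq : constantCoeff q = 1) : p = q := by
  refine (sq_eq_sq_iff_eq_or_eq_neg.mp h).resolve_right fun hneg => ?_
  have := congrArg constantCoeff hneg
  rw [map_neg, hp, hq] at this
  norm_num at this

/-- The Taylor coefficients of `1 / √(1 - z)` at `0`. -/
noncomputable def invSqrtCoeff (k : ℕ) : ℝ := (k.centralBinom : ℝ) / 4 ^ k

theorem invSqrtCoeff_zero : invSqrtCoeff 0 = 1 := by simp [invSqrtCoeff]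

theorem invSqrtCoeff_pos (k : ℕ) : 0 < invSqrtCoeff k := by
  have := k.centralBinom_pos
  unfold invSqrtCoeff
  positivity

theorem invSqrtCoeff_succ (k : ℕ) :
    invSqrtCoeff (k + 1) = (2 * k + 1) / (2 * k + 2) * invSqrtCoeff k := by
  have h : ((k : ℝ) + 1) * (k + 1).centralBinom = 2 * (2 * k + 1) * k.centralBinom := by
    exact_mod_cast Nat.succ_mul_centralBinom_succ k
  unfold invSqrtCoeff
  rw [pow_succ]
  field_simp
  linear_combination 2 * h

theorem invSqrtCoeff_succ_lt (k : ℕ) : invSqrtCoeff (k + 1) < invSqrtCoeff k := by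
  rw [invSqrtCoeff_succ]
  refine mul_lt_of_lt_one_left (invSqrtCoeff_pos k) ?_
  rw [div_lt_one (by positivity)]
  linarith

theorem strictMono_invSqrtCoeff_ratio :
    StrictMono fun i : ℕ => invSqrtCoeff (3 * i + 1) / invSqrtCoeff i := by
  refine strictMono_nat_of_lt_succ fun i => ?_
  have hi := invSqrtCoeff_pos i
  have hj := invSqrtCoeff_pos (3 * i + 1)
  rw [show 3 * (i + 1) + 1 = 3 * i + 1 + 1 + 1 + 1 by ring, invSqrtCoeff_succ i,
    invSqrtCoeff_succ (3 * i + 1 + 1 + 1), invSqrtCoeff_succ (3 * i + 1 + 1),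
    invSqrtCoeff_succ (3 * i + 1)]
  rw [div_lt_div_iff₀ hi (by positivity)]
  push_cast
  have key : (2 * (i : ℝ) + 1) / (2 * i + 2) <
      (2 * (3 * i + 1 + 1 + 1) + 1) / (2 * (3 * i + 1 + 1 + 1) + 2) *
      ((2 * (3 * i + 1 + 1) + 1) / (2 * (3 * i + 1 + 1) + 2) *
      ((2 * (3 * i + 1) + 1) / (2 * (3 * i + 1) + 2))) := by
    rw [div_mul_div_comm, div_mul_div_comm, div_lt_div_iff₀ (by positivity) (by positivity)]
    have : (0 : ℝ) ≤ i := i.cast_nonneg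
    nlinarith [mul_nonneg this this]
  have := mul_lt_mul_of_pos_right key (mul_pos hj hi)
  linarith

/-- The power series of `1 / √(1 - z)`. -/
noncomputable def invSqrtSeries : PowerSeries ℝ := PowerSeries.mk invSqrtCoeff

theorem constantCoeff_invSqrtSeries : constantCoeff invSqrtSeries = 1 := by
  rw [← coeff_zero_eq_constantCoeff_apply, invSqrtSeries, coeff_mk, invSqrtCoeff_zero]

theorem two_mul_derivative_invSqrtSeries :
    2 * d⁄dX ℝ invSqrtSeries * (1 - X) = invSqrtSeries := by
  have hX : ∀ k : ℕ, 2 * ((k : ℝ) + 1) * invSqrtCoeff (k + 1) = (2 * k + 1) * invSqrtCoeff k := by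
    intro k
    rw [invSqrtCoeff_succ]
    field_simp
  have h2 : (2 : PowerSeries ℝ) = C (2 : ℝ) := (map_ofNat C 2).symm
  ext k
  rw [mul_sub, mul_one, map_sub, h2]
  cases k with
  | zero =>
    have := hX 0
    simp [invSqrtSeries, coeff_derivative] at this ⊢
    linarith
  | succ k =>
    have h0 := hX k
    have h1 := hX (k + 1)
    rw [coeff_succ_mul_X, coeff_C_mul, coeff_C_mul, coeff_derivative, coeff_derivative]
    simp only [invSqrtSeries, coeff_mk]
    push_cast at h0 h1 ⊢
    linarith

theorem invSqrtSeries_sq_mul : invSqrtSeries ^ 2 * (1 - X) = 1 := by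
  refine PowerSeries.derivative.ext ?_ ?_
  · have h := two_mul_derivative_invSqrtSeries
    simp only [Derivation.leibniz, Derivation.leibniz_pow, map_sub, Derivation.map_one_eq_zero,
      derivative_X, smul_eq_mul, nsmul_eq_mul]
    push_cast
    linear_combination invSqrtSeries * h
  · simp [constantCoeff_invSqrtSeries]

/-- The power series of `√(1 - z)`. -/
noncomputable def sqrtSeries : PowerSeries ℝ := (1 - X) * invSqrtSeries

theorem constantCoeff_sqrtSeries : constantCoeff sqrtSeries = 1 := by
  simp [sqrtSeries, constantCoeff_invSqrtSeries]

theorem sqrtSeries_sq : sqrtSeries ^ 2 = 1 - X := by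
  unfold sqrtSeries
  linear_combination (1 - X) * invSqrtSeries_sq_mul

theorem sqrtSeries_mul_invSqrtSeries : sqrtSeries * invSqrtSeries = 1 := by
  unfold sqrtSeries
  linear_combination invSqrtSeries_sq_mul

theorem coeff_succ_sqrtSeries_neg (k : ℕ) : coeff (k + 1) sqrtSeries < 0 := by
  rw [sqrtSeries, sub_mul, one_mul, map_sub, coeff_succ_X_mul]
  simpa [invSqrtSeries] using invSqrtCoeff_succ_lt k

theorem coeff_expand_sqrtSeries_mul_invSqrtSeries (m : ℕ) :
    coeff (3 * m + 1) (expand 3 three_ne_zero sqrtSeries * invSqrtSeries) =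
      ∑ j ∈ range (m + 1), coeff j sqrtSeries * invSqrtCoeff (3 * (m - j) + 1) := by
  rw [coeff_mul, Nat.sum_antidiagonal_eq_sum_range_succ
    (fun i j => coeff i (expand 3 three_ne_zero sqrtSeries) * coeff j invSqrtSeries)]
  symm
  refine Finset.sum_of_injOn (fun j => 3 * j) (fun a _ b _ h => by simpa using h) ?_ ?_ ?_
  · intro j hj
    simp only [coe_range, Set.mem_Iio] at hj ⊢
    omega
  · intro k hk hk'
    rw [coeff_expand_of_not_dvd, zero_mul]
    rintro ⟨j, rfl⟩
    refine hk' ⟨j, ?_, rfl⟩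
    simp only [coe_range, Set.mem_Iio, mem_range] at hk ⊢
    omega
  · intro j hj
    rw [mem_range] at hj
    rw [coeff_expand_mul, invSqrtSeries, coeff_mk,
      show 3 * m + 1 - 3 * j = 3 * (m - j) + 1 by omega]

theorem coeff_expand_sqrtSeries_mul_invSqrtSeries_pos {m : ℕ} (hm : m ≠ 0) :
    0 < coeff (3 * m + 1) (expand 3 three_ne_zero sqrtSeries * invSqrtSeries) := by
  set r : ℕ → ℝ := fun i => invSqrtCoeff (3 * i + 1) / invSqrtCoeff i with hr
  have hzero : ∑ j ∈ range (m + 1), coeff j sqrtSeries * invSqrtCoeff (m - j) = 0 := by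
    have h := congrArg (coeff m) sqrtSeries_mul_invSqrtSeries
    rw [coeff_mul, Nat.sum_antidiagonal_eq_sum_range_succ
      (fun i j => coeff i sqrtSeries * coeff j invSqrtSeries), coeff_one, if_neg hm] at h
    simpa [invSqrtSeries] using h
  have hsum : ∑ j ∈ range (m + 1), coeff j sqrtSeries * invSqrtCoeff (3 * (m - j) + 1) =
      ∑ j ∈ range (m + 1), coeff j sqrtSeries * invSqrtCoeff (m - j) * (r (m - j) - r m) := by
    simp only [mul_sub, Finset.sum_sub_distrib]
    rw [← Finset.sum_mul, hzero, zero_mul, sub_zero]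
    refine Finset.sum_congr rfl fun j _ => ?_
    rw [hr]
    have := (invSqrtCoeff_pos (m - j)).ne'
    field_simp
  rw [coeff_expand_sqrtSeries_mul_invSqrtSeries, hsum, Finset.sum_range_succ']
  simp only [Nat.sub_zero, sub_self, mul_zero, add_zero]
  refine Finset.sum_pos (fun j hj => ?_) (by simpa using hm)
  refine mul_pos_of_neg_of_neg
    (mul_neg_of_neg_of_pos (coeff_succ_sqrtSeries_neg j) (invSqrtCoeff_pos _)) (sub_neg.mpr ?_)
  exact strictMono_invSqrtCoeff_ratio (by rw [mem_range] at hj; omega)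

theorem cpow_half_mul_self (w : ℂ) : w ^ ((1 : ℂ) / 2) * w ^ ((1 : ℂ) / 2) = w := by
  rw [← sq, one_div]
  exact_mod_cast Complex.cpow_nat_inv_pow w two_ne_zero

/-- Let `b_k` be the Taylor coefficients of the principal branch of
`√(1+z+z²)`, `T_n(z) = ∑_{k=0}^n b_k z^k`, and let `γ_k` be the Taylor coefficients at
`0` of `T_n(z)√(1-z)`. If `n ≥ 1` is divisible by `3`, then `γ_{n+1} = -b_{n+1}`; in
particular `γ_{n+1} < 0`. -/
theorem product_coeff_np1
    (b : ℕ → ℝ)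
    (hb : ∀ᶠ z : ℂ in nhds 0,
      HasSum (fun k : ℕ => (b k : ℂ) * z ^ k) ((1 + z + z ^ 2) ^ ((1 : ℂ) / 2)))
    (n : ℕ) (hn : 1 ≤ n) (hn3 : 3 ∣ n) (γ : ℕ → ℝ)
    (hγ : ∀ᶠ z : ℂ in nhds 0,
      HasSum (fun k : ℕ => (γ k : ℂ) * z ^ k)
        ((∑ k ∈ Finset.range (n + 1), (b k : ℂ) * z ^ k) * (1 - z) ^ ((1 : ℂ) / 2))) :
    γ (n + 1) = - b (n + 1) ∧ γ (n + 1) < 0 := by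
  set B : PowerSeries ℝ := PowerSeries.mk b with hB
  set G : PowerSeries ℝ := PowerSeries.mk γ with hG
  set P : Polynomial ℝ := ∑ k ∈ range (n + 1), Polynomial.monomial k (b k) with hP
  have hBt : HasRealTaylor B fun z => (1 + z + z ^ 2) ^ ((1 : ℂ) / 2) := by
    simpa [HasRealTaylor, hB] using hb
  have hGt : HasRealTaylor G fun z =>
      (∑ k ∈ Finset.range (n + 1), (b k : ℂ) * z ^ k) * (1 - z) ^ ((1 : ℂ) / 2) := by
    simpa [HasRealTaylor, hG] using hγ
  have hPt : HasRealTaylor P fun z => ∑ k ∈ Finset.range (n + 1), (b k : ℂ) * z ^ k :=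
    (HasRealTaylor.of_polynomial P).congr fun z => by simp [hP, Polynomial.aeval_monomial]
  have hcoeffP : ∀ k, coeff k (P : PowerSeries ℝ) = if k < n + 1 then b k else 0 := by
    intro k
    simp [hP, Polynomial.coeff_monomial]
  have hB0 : constantCoeff B = 1 := by
    have h := hBt.constantCoeff_eq
    simpa using h
  have hb0 : b 0 = 1 := by simpa [hB] using hB0
  have hG0 : constantCoeff G = 1 := by
    have h := hGt.constantCoeff_eq
    simpa [Finset.sum_range_succ', hb0] using h
  have hP0 : constantCoeff (P : PowerSeries ℝ) = 1 := by
    rw [← coeff_zero_eq_constantCoeff_apply, hcoeffP, if_pos n.succ_pos, hb0]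
  have hBsq : B ^ 2 = 1 + X + X ^ 2 := by
    have hQ := HasRealTaylor.of_polynomial (1 + Polynomial.X + Polynomial.X ^ 2)
    rw [Polynomial.coe_add, Polynomial.coe_add, Polynomial.coe_one, Polynomial.coe_pow,
      Polynomial.coe_X] at hQ
    rw [sq B]
    refine (hBt.mul hBt).unique (hQ.congr fun z => ?_)
    rw [cpow_half_mul_self]
    simp
  have hGsq : G ^ 2 = (P : PowerSeries ℝ) ^ 2 * (1 - X) := by
    rw [sq, sq]
    refine (hGt.mul hGt).unique ?_
    have hX : HasRealTaylor (1 - X) fun z => 1 - z := by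
      have hQ := HasRealTaylor.of_polynomial (1 - Polynomial.X)
      rw [Polynomial.coe_sub, Polynomial.coe_one, Polynomial.coe_X] at hQ
      exact hQ.congr fun z => by simp
    refine ((hPt.mul hPt).mul hX).congr fun z => ?_
    rw [mul_mul_mul_comm, cpow_half_mul_self]
  have hBS : B * sqrtSeries = expand 3 three_ne_zero sqrtSeries := by
    refine PowerSeries.eq_of_sq_eq_sq ?_ (by simp [hB0, constantCoeff_sqrtSeries])
      (by simp [constantCoeff_sqrtSeries])
    rw [mul_pow, hBsq, sqrtSeries_sq, ← map_pow, sqrtSeries_sq, map_sub, map_one, expand_X]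
    ring
  have hGS : G = P * sqrtSeries := by
    refine PowerSeries.eq_of_sq_eq_sq ?_ hG0 (by simp [hP0, constantCoeff_sqrtSeries])
    rw [mul_pow, hGsq, sqrtSeries_sq]
  have hBE : B = expand 3 three_ne_zero sqrtSeries * invSqrtSeries := by
    rw [← hBS, mul_assoc, sqrtSeries_mul_invSqrtSeries, mul_one]
  have hbpos : 0 < b (n + 1) := by
    obtain ⟨m, rfl⟩ := hn3
    have h := coeff_expand_sqrtSeries_mul_invSqrtSeries_pos (m := m) (by omega)
    rwa [← hBE, hB, coeff_mk] at h
  have heq : γ (n + 1) = - b (n + 1) := by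
    have h := congrArg (coeff (n + 1)) hBS
    rw [coeff_expand_of_not_dvd _ _ _ (by omega), coeff_mul,
      Nat.sum_antidiagonal_eq_sum_range_succ (fun i j => coeff i B * coeff j sqrtSeries),
      Finset.sum_range_succ, Nat.sub_self, coeff_zero_eq_constantCoeff_apply,
      constantCoeff_sqrtSeries, mul_one] at h
    have h' := congrArg (coeff (n + 1)) hGS
    rw [coeff_mul, Nat.sum_antidiagonal_eq_sum_range_succ
      (fun i j => coeff i (P : PowerSeries ℝ) * coeff j sqrtSeries),
      Finset.sum_range_succ, hcoeffP (n + 1), if_neg (lt_irrefl _), zero_mul, add_zero,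
      Finset.sum_congr rfl fun k hk => by rw [hcoeffP k, if_pos (mem_range.mp hk)]] at h'
    simp only [hB, hG, coeff_mk] at h h'
    linarith
  exact ⟨heq, by linarith⟩
end

section
/- Fix n ≥ 0 and define the polynomial P(x) = ∑_{s=0}^n b_s · x^(s̲) · (x − s − 3/2)^((n−s)̲), where x^(m̲) is the falling factorial. Then every complex root of P is real and lies in the interval [1, n+1); consequently, since the leading coefficient of P equals T_n(1) > 0, P(x) > 0 for every real x ≥ n + 1. -/
open Finset

/-- The falling factorial `x^(m̲) = x(x-1)⋯(x-m+1)` for a complex argument. -/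
def fallC (x : ℂ) (m : ℕ) : ℂ := ∏ i ∈ Finset.range m, (x - i)

/-- The falling factorial `x^(m̲) = x(x-1)⋯(x-m+1)` for a real argument. -/
def fallR (x : ℝ) (m : ℕ) : ℝ := ∏ i ∈ Finset.range m, (x - i)

/-- The Taylor coefficients at `0` of `(1 - z) ^ r`. -/
noncomputable def oneSubPowCoeff (r : ℝ) (k : ℕ) : ℝ := ∏ i ∈ range k, (i - r) / (i + 1)

lemma oneSubPowCoeff_zero (r : ℝ) : oneSubPowCoeff r 0 = 1 := by simp [oneSubPowCoeff]

lemma oneSubPowCoeff_succ (r : ℝ) (k : ℕ) :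
    oneSubPowCoeff r (k + 1) = oneSubPowCoeff r k * ((k - r) / (k + 1)) := by
  rw [oneSubPowCoeff, prod_range_succ, oneSubPowCoeff]

lemma mk_oneSubPowCoeff (r : ℝ) :
    PowerSeries.mk (oneSubPowCoeff r) =
      PowerSeries.rescale (-1) (PowerSeries.binomialSeries ℝ r) := by
  ext k
  rw [PowerSeries.coeff_mk, PowerSeries.coeff_rescale, PowerSeries.binomialSeries_coeff,
    Ring.choose_eq_smul, ← Polynomial.aeval_eq_smeval, ← Polynomial.eval_map_algebraMap,
    descPochhammer_map, descPochhammer_eval_eq_prod_range]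
  simp only [smul_eq_mul, mul_one]
  induction k with
  | zero => simp [oneSubPowCoeff]
  | succ k ih =>
    rw [oneSubPowCoeff_succ, ih, prod_range_succ, Nat.factorial_succ]
    push_cast
    field_simp
    ring

lemma mk_oneSubPowCoeff_add (r s : ℝ) :
    PowerSeries.mk (oneSubPowCoeff (r + s)) =
      PowerSeries.mk (oneSubPowCoeff r) * PowerSeries.mk (oneSubPowCoeff s) := by
  simp only [mk_oneSubPowCoeff, PowerSeries.binomialSeries_add, map_mul]

lemma mk_oneSubPowCoeff_one :
    PowerSeries.mk (oneSubPowCoeff 1) = 1 - PowerSeries.X := by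
  have h := PowerSeries.binomialSeries_nat (R := ℝ) (A := ℝ) 1
  rw [Nat.cast_one, pow_one] at h
  rw [mk_oneSubPowCoeff, h, map_add, map_one, PowerSeries.rescale_X]
  simp [sub_eq_add_neg]

lemma mk_oneSubPowCoeff_zero :
    PowerSeries.mk (oneSubPowCoeff 0) = 1 := by
  rw [mk_oneSubPowCoeff, PowerSeries.binomialSeries_zero, map_one]

section Coefficients

variable {b : ℕ → ℝ}

lemma coeff_zero_eq_one
    (hb : ∀ᶠ z : ℂ in nhds 0,
      HasSum (fun k : ℕ => (b k : ℂ) * z ^ k) ((1 + z + z ^ 2) ^ ((1 : ℂ) / 2))) : b 0 = 1 := by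
  have h0 := hb.self_of_nhds
  have h1 := hasSum_single (f := fun k : ℕ => (b k : ℂ) * 0 ^ k) 0 (fun k hk => by simp [hk])
  have := h0.unique h1
  simp at this
  exact_mod_cast this.symm

lemma mk_mul_self_eq
    (hb : ∀ᶠ z : ℂ in nhds 0,
      HasSum (fun k : ℕ => (b k : ℂ) * z ^ k) ((1 + z + z ^ 2) ^ ((1 : ℂ) / 2))) :
    PowerSeries.mk b * PowerSeries.mk b = 1 + PowerSeries.X + PowerSeries.X ^ 2 := by
  set q : PowerSeries ℝ := 1 + PowerSeries.X + PowerSeries.X ^ 2 with hq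
  have h1 : HasFPowerSeriesAt (fun z : ℂ => 1 + z + z ^ 2) (FormalMultilinearSeries.ofScalars ℂ
      (fun k => ((PowerSeries.coeff k (PowerSeries.mk b * PowerSeries.mk b) : ℝ) : ℂ))) 0 := by
    rw [hasFPowerSeriesAt_iff]
    filter_upwards [hb] with z hz
    have hs := hz.summable.norm
    have := hasSum_sum_range_mul_of_summable_norm hs hs
    rw [hz.tsum_eq, ← sq, one_div, Complex.cpow_ofNat_inv_pow] at this
    simp only [zero_add]
    convert! this using 2 with k
    rw [FormalMultilinearSeries.coeff_ofScalars, PowerSeries.coeff_mul,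
      Nat.sum_antidiagonal_eq_sum_range_succ_mk, smul_eq_mul, Complex.ofReal_sum, mul_sum]
    refine sum_congr rfl fun i hi => ?_
    have : i ≤ k := by simpa [Nat.lt_succ_iff] using hi
    rw [← Nat.add_sub_cancel' this, pow_add]
    simp
    ring
  have h2 : HasFPowerSeriesAt (fun z : ℂ => 1 + z + z ^ 2) (FormalMultilinearSeries.ofScalars ℂ
      (fun k => ((PowerSeries.coeff k q : ℝ) : ℂ))) 0 := by
    rw [hasFPowerSeriesAt_iff]
    refine Filter.Eventually.of_forall fun z => ?_
    have := hasSum_sum_of_ne_finset_zero (L := .unconditional ℕ) (s := range 3)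
      (f := fun k : ℕ => z ^ k • (FormalMultilinearSeries.ofScalars ℂ
        (fun k => ((PowerSeries.coeff k q : ℝ) : ℂ))).coeff k) (fun k hk => ?_)
    · convert! this using 1
      simp [sum_range_succ, hq, PowerSeries.coeff_X, PowerSeries.coeff_X_pow, PowerSeries.coeff_one]
    · have hk3 : 3 ≤ k := by simpa using hk
      have h0 : k ≠ 0 := by lia
      have h1 : k ≠ 1 := by lia
      have h2 : k ≠ 2 := by lia
      simp [hq, PowerSeries.coeff_X, PowerSeries.coeff_X_pow, PowerSeries.coeff_one, h0, h1, h2]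
  have h3 := h1.eq_formalMultilinearSeries h2
  ext k
  have := congrArg (fun p => p.coeff k) h3
  simpa using this

lemma mk_mul_oneSubPowCoeff
    (hb : ∀ᶠ z : ℂ in nhds 0,
      HasSum (fun k : ℕ => (b k : ℂ) * z ^ k) ((1 + z + z ^ 2) ^ ((1 : ℂ) / 2))) :
    PowerSeries.mk b * PowerSeries.mk (oneSubPowCoeff (1 / 2)) =
      PowerSeries.expand 3 three_ne_zero (PowerSeries.mk (oneSubPowCoeff (1 / 2))) := by
  have hA : PowerSeries.mk (oneSubPowCoeff (1 / 2)) * PowerSeries.mk (oneSubPowCoeff (1 / 2)) =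
      1 - PowerSeries.X := by
    rw [← mk_oneSubPowCoeff_add, add_halves, mk_oneSubPowCoeff_one]
  have hsq : (PowerSeries.mk b * PowerSeries.mk (oneSubPowCoeff (1 / 2))) ^ 2 =
      (PowerSeries.expand 3 three_ne_zero (PowerSeries.mk (oneSubPowCoeff (1 / 2)))) ^ 2 := by
    rw [mul_pow, sq, sq, sq, mk_mul_self_eq hb, ← map_mul, hA, map_sub, map_one,
      PowerSeries.expand_X]
    ring
  rcases sq_eq_sq_iff_eq_or_eq_neg.mp hsq with h | h
  · exact h
  · have h0 := congrArg PowerSeries.constantCoeff h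
    rw [map_mul, map_neg, PowerSeries.constantCoeff_expand] at h0
    simp only [PowerSeries.constantCoeff_mk, coeff_zero_eq_one hb, oneSubPowCoeff_zero] at h0
    norm_num at h0

lemma sum_mul_oneSubPowCoeff
    (hb : ∀ᶠ z : ℂ in nhds 0,
      HasSum (fun k : ℕ => (b k : ℂ) * z ^ k) ((1 + z + z ^ 2) ^ ((1 : ℂ) / 2))) (m : ℕ) :
    ∑ s ∈ range (m + 1), b s * oneSubPowCoeff (1 / 2) (m - s) =
      if 3 ∣ m then oneSubPowCoeff (1 / 2) (m / 3) else 0 := by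
  have h := congrArg (PowerSeries.coeff m) (mk_mul_oneSubPowCoeff hb)
  rw [PowerSeries.coeff_mul, PowerSeries.coeff_expand,
    Nat.sum_antidiagonal_eq_sum_range_succ_mk] at h
  simpa only [PowerSeries.coeff_mk] using h

lemma mk_oneSubPowCoeff_half_mul_neg_half :
    PowerSeries.mk (oneSubPowCoeff (1 / 2)) * PowerSeries.mk (oneSubPowCoeff (-1 / 2)) = 1 := by
  rw [← mk_oneSubPowCoeff_add, ← mk_oneSubPowCoeff_zero]
  norm_num

lemma coeff_eq_sum
    (hb : ∀ᶠ z : ℂ in nhds 0,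
      HasSum (fun k : ℕ => (b k : ℂ) * z ^ k) ((1 + z + z ^ 2) ^ ((1 : ℂ) / 2))) (m : ℕ) :
    b m = ∑ s ∈ range (m + 1), (if 3 ∣ s then oneSubPowCoeff (1 / 2) (s / 3) else 0) *
      oneSubPowCoeff (-1 / 2) (m - s) := by
  have h : PowerSeries.mk b =
      PowerSeries.expand 3 three_ne_zero (PowerSeries.mk (oneSubPowCoeff (1 / 2))) *
        PowerSeries.mk (oneSubPowCoeff (-1 / 2)) := by
    rw [← mk_mul_oneSubPowCoeff hb, mul_assoc, mk_oneSubPowCoeff_half_mul_neg_half, mul_one]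
  have h := congrArg (PowerSeries.coeff m) h
  rw [PowerSeries.coeff_mul, Nat.sum_antidiagonal_eq_sum_range_succ_mk] at h
  simpa only [PowerSeries.coeff_mk, PowerSeries.coeff_expand] using h

lemma sum_half_mul_neg_half {j : ℕ} (hj : j ≠ 0) :
    ∑ k ∈ range (j + 1), oneSubPowCoeff (1 / 2) k * oneSubPowCoeff (-1 / 2) (j - k) = 0 := by
  have h := congrArg (PowerSeries.coeff j) mk_oneSubPowCoeff_half_mul_neg_half
  rw [PowerSeries.coeff_mul, Nat.sum_antidiagonal_eq_sum_range_succ_mk] at h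
  simpa only [PowerSeries.coeff_mk, PowerSeries.coeff_one, if_neg hj] using h

lemma oneSubPowCoeff_neg_half_pos (k : ℕ) : 0 < oneSubPowCoeff (-1 / 2) k :=
  prod_pos fun i _ => div_pos (by linarith [(Nat.cast_nonneg i : (0 : ℝ) ≤ i)]) (by positivity)

lemma oneSubPowCoeff_half_neg (k : ℕ) : oneSubPowCoeff (1 / 2) (k + 1) < 0 := by
  induction k with
  | zero => norm_num [oneSubPowCoeff]
  | succ k ih =>
    rw [oneSubPowCoeff_succ]
    refine mul_neg_of_neg_of_pos ih (div_pos ?_ (by positivity))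
    push_cast
    linarith [(Nat.cast_nonneg k : (0 : ℝ) ≤ k)]

lemma sum_half_mul_pos {u : ℕ → ℝ} (hu : ∀ i, 0 < u i)
    (hmono : ∀ i, u i * oneSubPowCoeff (-1 / 2) (i + 1) < u (i + 1) * oneSubPowCoeff (-1 / 2) i)
    (j : ℕ) : 0 < ∑ k ∈ range (j + 1), oneSubPowCoeff (1 / 2) k * u (j - k) := by
  rcases Nat.eq_zero_or_pos j with rfl | hj
  · simpa [oneSubPowCoeff_zero] using hu 0
  set d := oneSubPowCoeff (-1 / 2) with hd
  have hdpos : ∀ i, 0 < d i := oneSubPowCoeff_neg_half_pos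
  have hg : StrictMono fun i => u i / d i := strictMono_nat_of_lt_succ fun i => by
    rw [div_lt_div_iff₀ (hdpos _) (hdpos _)]
    exact hmono i
  have hzero := sum_half_mul_neg_half hj.ne'
  have hrw : ∑ k ∈ range (j + 1), oneSubPowCoeff (1 / 2) k * u (j - k) =
      ∑ k ∈ range (j + 1), oneSubPowCoeff (1 / 2) k * d (j - k) *
        (u (j - k) / d (j - k) - u j / d j) := by
    simp only [mul_sub, sum_sub_distrib]
    rw [← sum_mul, hzero, zero_mul, sub_zero]
    refine sum_congr rfl fun k _ => ?_
    have := (hdpos (j - k)).ne'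
    field_simp
  rw [hrw, sum_range_succ', Nat.sub_zero, sub_self, mul_zero, add_zero]
  refine sum_pos (fun k hk => ?_) ⟨0, by simpa using hj⟩
  have hlt : j - (k + 1) < j := by have := mem_range.mp hk; lia
  exact mul_pos_of_neg_of_neg
    (mul_neg_of_neg_of_pos (oneSubPowCoeff_half_neg k) (hdpos _)) (sub_neg.mpr (hg hlt))

lemma neg_half_arith_progression (r i : ℕ) :
    oneSubPowCoeff (-1 / 2) (3 * i + (r + 1)) * oneSubPowCoeff (-1 / 2) (i + 1) <
      oneSubPowCoeff (-1 / 2) (3 * (i + 1) + (r + 1)) * oneSubPowCoeff (-1 / 2) i := by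
  have h1 := oneSubPowCoeff_neg_half_pos (3 * i + (r + 1))
  have h2 := oneSubPowCoeff_neg_half_pos i
  rw [show 3 * (i + 1) + (r + 1) = 3 * i + (r + 1) + 1 + 1 + 1 by ring, oneSubPowCoeff_succ _ i,
    oneSubPowCoeff_succ, oneSubPowCoeff_succ, oneSubPowCoeff_succ]
  have key : ((i : ℝ) - -1 / 2) / (i + 1) <
      (((3 * i + (r + 1) : ℕ) : ℝ) - -1 / 2) / (((3 * i + (r + 1) : ℕ) : ℝ) + 1) *
      ((((3 * i + (r + 1) + 1 : ℕ) : ℝ) - -1 / 2) / (((3 * i + (r + 1) + 1 : ℕ) : ℝ) + 1)) *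
      ((((3 * i + (r + 1) + 1 + 1: ℕ) : ℝ) - -1 / 2) /
        (((3 * i + (r + 1) + 1 + 1 : ℕ) : ℝ) + 1)) := by
    rw [div_mul_div_comm, div_mul_div_comm, div_lt_div_iff₀ (by positivity) (by positivity)]
    push_cast
    rw [← sub_pos]
    ring_nf
    positivity
  calc _ = oneSubPowCoeff (-1 / 2) (3 * i + (r + 1)) * oneSubPowCoeff (-1 / 2) i *
        (((i : ℝ) - -1 / 2) / (i + 1)) := by ring
    _ < _ := mul_lt_mul_of_pos_left key (mul_pos h1 h2)
    _ = _ := by ring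

lemma sum_dvd_three (f g : ℕ → ℝ) (j : ℕ) :
    ∑ s ∈ range (3 * j), (if 3 ∣ s then f (s / 3) else 0) * g s =
      ∑ k ∈ range j, f k * g (3 * k) := by
  induction j with
  | zero => simp
  | succ j ih =>
    rw [show 3 * (j + 1) = 3 * j + 1 + 1 + 1 by ring, sum_range_succ, sum_range_succ,
      sum_range_succ, ih, sum_range_succ, if_pos (by lia), if_neg (by lia), if_neg (by lia),
      Nat.mul_div_cancel_left _ three_pos]
    ring

lemma dvd_three_coeff_lt
    (hb : ∀ᶠ z : ℂ in nhds 0,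
      HasSum (fun k : ℕ => (b k : ℂ) * z ^ k) ((1 + z + z ^ 2) ^ ((1 : ℂ) / 2))) (m : ℕ) :
    (if 3 ∣ m + 1 then oneSubPowCoeff (1 / 2) ((m + 1) / 3) else 0) < b (m + 1) := by
  rw [coeff_eq_sum hb, sum_range_succ, Nat.sub_self, oneSubPowCoeff_zero, mul_one, ← sub_pos,
    add_sub_cancel_right]
  have h := sum_half_mul_pos (fun i => oneSubPowCoeff_neg_half_pos (3 * i + (m % 3 + 1)))
    (neg_half_arith_progression (m % 3)) (m / 3)
  have hext : ∑ s ∈ range (m + 1), (if 3 ∣ s then oneSubPowCoeff (1 / 2) (s / 3) else 0) *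
      oneSubPowCoeff (-1 / 2) (m + 1 - s) =
      ∑ s ∈ range (3 * (m / 3 + 1)), (if 3 ∣ s then oneSubPowCoeff (1 / 2) (s / 3) else 0) *
      oneSubPowCoeff (-1 / 2) (m + 1 - s) := by
    refine sum_subset (range_subset_range.mpr (by lia)) fun s hs hs' => ?_
    rw [mem_range] at hs hs'
    rw [if_neg (by lia), zero_mul]
  rw [hext, sum_dvd_three _ fun s => oneSubPowCoeff (-1 / 2) (m + 1 - s)]
  convert! h using 4 with k hk
  have := mem_range.mp hk
  lia

end Coefficients

section FallingFactorial

lemma fallR_succ (x : ℝ) (m : ℕ) : fallR x (m + 1) = fallR x m * (x - m) :=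
  prod_range_succ _ _

lemma fallR_add (x : ℝ) (j k : ℕ) : fallR x (j + k) = fallR x j * fallR (x - j) k := by
  rw [fallR, prod_range_add, fallR, fallR]
  congr 1
  refine prod_congr rfl fun i _ => ?_
  push_cast
  ring

lemma fallR_natCast_add (s k : ℕ) : fallR ((s + k : ℕ) : ℝ) s * k.factorial = (s + k).factorial := by
  rw [fallR, ← descPochhammer_eval_eq_prod_range, descPochhammer_eval_eq_descFactorial,
    mul_comm]
  exact_mod_cast by simpa using Nat.factorial_mul_descFactorial (Nat.le_add_right s k)

lemma fallR_natCast_eq_zero {m s : ℕ} (h : m < s) : fallR m s = 0 :=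
  prod_eq_zero (mem_range.mpr h) (sub_self _)

lemma fallR_sub_three_halves (k : ℕ) :
    fallR (k - 3 / 2) k = k.factorial * oneSubPowCoeff (1 / 2) k := by
  have h : fallR (k - 3 / 2) k = ∏ i ∈ range k, ((i : ℝ) - 1 / 2) := by
    rw [fallR, ← prod_range_reflect]
    refine prod_congr rfl fun i hi => ?_
    have hi := mem_range.mp hi
    rw [Nat.sub_sub, Nat.cast_sub (by lia)]
    push_cast
    ring
  rw [h]
  clear h
  induction k with
  | zero => simp [oneSubPowCoeff]
  | succ k ih =>
    rw [prod_range_succ, ih, oneSubPowCoeff_succ, Nat.factorial_succ]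
    push_cast
    field_simp

lemma neg_one_pow_mul_fallR_pos (j : ℕ) : 0 < (-1) ^ j * fallR (-3 / 2) j := by
  induction j with
  | zero => simp [fallR]
  | succ j ih =>
    rw [fallR_succ, pow_succ]
    have : (0 : ℝ) < 3 / 2 + j := by positivity
    calc 0 < (-1) ^ j * fallR (-3 / 2) j * (3 / 2 + j) := mul_pos ih this
      _ = _ := by ring

lemma sum_fallR_natCast (b : ℕ → ℝ) {m n : ℕ} (hmn : m ≤ n) :
    ∑ s ∈ range (n + 1), b s * fallR m s * fallR ((m : ℝ) - s - 3 / 2) (n - s) =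
      m.factorial * fallR (-3 / 2) (n - m) *
        ∑ s ∈ range (m + 1), b s * oneSubPowCoeff (1 / 2) (m - s) := by
  rw [← sum_subset (range_subset_range.mpr (Nat.succ_le_succ hmn)), mul_sum]
  · refine sum_congr rfl fun s hs => ?_
    obtain ⟨k, rfl⟩ := Nat.exists_eq_add_of_le (Nat.lt_succ_iff.mp (mem_range.mp hs))
    rw [show n - s = k + (n - (s + k)) by lia,
      show (((s + k : ℕ) : ℝ) - s - 3 / 2) = k - 3 / 2 by push_cast; ring, fallR_add,
      fallR_sub_three_halves, show (k : ℝ) - 3 / 2 - k = -3 / 2 by ring, Nat.add_sub_cancel_left,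
      ← fallR_natCast_add]
    ring
  · intro s _ hs
    rw [fallR_natCast_eq_zero (by simpa using hs), mul_zero, zero_mul]

lemma sum_fallR_natCast_succ (b : ℕ → ℝ) (n : ℕ) :
    ∑ s ∈ range (n + 1), b s * fallR (n + 1 : ℕ) s * fallR (((n + 1 : ℕ) : ℝ) - s - 3 / 2) (n - s) =
      2 * (n + 1).factorial *
        (b (n + 1) - ∑ s ∈ range (n + 2), b s * oneSubPowCoeff (1 / 2) (n + 1 - s)) := by
  rw [sum_range_succ _ (n + 1), Nat.sub_self, oneSubPowCoeff_zero, mul_one, sub_add_cancel_right,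
    mul_neg, mul_sum, ← sum_neg_distrib]
  refine sum_congr rfl fun s hs => ?_
  obtain ⟨k, rfl⟩ := Nat.exists_eq_add_of_le (Nat.lt_succ_iff.mp (mem_range.mp hs))
  have h1 := fallR_natCast_add s (k + 1)
  have h2 := fallR_sub_three_halves (k + 1)
  rw [fallR_succ] at h2
  rw [show (((s + k + 1 : ℕ) : ℝ) - s - 3 / 2) = (k + 1 : ℕ) - 3 / 2 by push_cast; ring,
    Nat.add_sub_cancel_left, show s + k + 1 - s = k + 1 by lia, add_assoc, ← h1]
  have h3 : fallR ((k + 1 : ℕ) - 3 / 2) k =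
      -2 * ((k + 1).factorial * oneSubPowCoeff (1 / 2) (k + 1)) := by
    rw [← h2]
    push_cast
    ring
  rw [h3]
  ring

end FallingFactorial

section RealRoots

open Polynomial

/-- The product of `X - C j` over `1 ≤ j ≤ n` with `3 ∤ j`. -/
noncomputable def nonMultiplesPoly (n : ℕ) : ℝ[X] :=
  ∏ j ∈ (Icc 1 n).filter fun j => ¬ 3 ∣ j, (X - C (j : ℝ))

lemma nonMultiplesPoly_succ (n : ℕ) :
    nonMultiplesPoly (n + 1) =
      if 3 ∣ n + 1 then nonMultiplesPoly n else nonMultiplesPoly n * (X - C ((n + 1 : ℕ) : ℝ)) := by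
  rw [nonMultiplesPoly, ← insert_Icc_right_eq_Icc_add_one (by lia), filter_insert]
  by_cases h : 3 ∣ n + 1
  · simp [h, nonMultiplesPoly]
  · rw [if_pos h, if_neg h, prod_insert (by simp), mul_comm, nonMultiplesPoly]

lemma natDegree_nonMultiplesPoly (n : ℕ) : (nonMultiplesPoly n).natDegree + n / 3 = n := by
  induction n with
  | zero => simp [nonMultiplesPoly]
  | succ n ih =>
    rw [nonMultiplesPoly_succ]
    split_ifs with h
    · lia
    · rw [natDegree_mul (prod_ne_zero_iff.mpr fun _ _ => X_sub_C_ne_zero _) (X_sub_C_ne_zero _),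
        natDegree_X_sub_C]
      lia

lemma eval_nonMultiplesPoly_pos {n : ℕ} {x : ℝ} (h : ∀ j : ℕ, j ≤ n → ¬ 3 ∣ j → (j : ℝ) < x) :
    0 < (nonMultiplesPoly n).eval x := by
  rw [nonMultiplesPoly, eval_prod]
  refine prod_pos fun j hj => ?_
  rw [mem_filter, mem_Icc] at hj
  simpa using h j hj.1.2 hj.2

lemma neg_one_pow_mul_eval_nonMultiplesPoly_pos {k n : ℕ} (h : 3 * k ≤ n) :
    0 < (-1) ^ (n % 3) * (nonMultiplesPoly n).eval ((3 * k : ℕ) : ℝ) := by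
  induction n, h using Nat.le_induction with
  | base =>
    rw [Nat.mul_mod_right, pow_zero, one_mul]
    refine eval_nonMultiplesPoly_pos fun j hj hj3 => ?_
    exact_mod_cast lt_of_le_of_ne hj (by lia)
  | succ n hn ih =>
    rw [nonMultiplesPoly_succ]
    split_ifs with h3
    · rw [show (n + 1) % 3 = 0 by lia]
      rwa [show n % 3 = 2 by lia, neg_one_sq] at ih
    · rw [show (n + 1) % 3 = n % 3 + 1 by lia, pow_succ, eval_mul, eval_sub, eval_X, eval_C]
      have : (0 : ℝ) < (n + 1 : ℕ) - (3 * k : ℕ) := sub_pos.mpr (by exact_mod_cast by lia)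
      calc 0 < _ := mul_pos ih this
        _ = _ := by ring

lemma nonMultiplesPoly_dvd {n : ℕ} {p : ℝ[X]}
    (h : ∀ j : ℕ, j ≤ n → ¬ 3 ∣ j → p.eval (j : ℝ) = 0) : nonMultiplesPoly n ∣ p := by
  refine prod_dvd_of_coprime (fun i _ j _ hij => ?_) fun j hj => ?_
  · exact isCoprime_X_sub_C_of_isUnit_sub (sub_ne_zero.mpr (by exact_mod_cast hij)).isUnit
  · rw [mem_filter, mem_Icc] at hj
    exact dvd_iff_isRoot.mpr (h j hj.1.2 hj.2)

/-- A polynomial of degree at most `K` that alternates in sign at `K + 1` increasing points has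
all its roots in the gaps between these points. -/
lemma eq_prod_of_alternating {Q : ℝ[X]} {K : ℕ} (hdeg : Q.natDegree ≤ K) {t : ℕ → ℝ}
    (ht : ∀ i < K, t i < t (i + 1)) (hsign : ∀ i ≤ K, 0 < (-1) ^ (i + K) * Q.eval (t i)) :
    ∃ y : ℕ → ℝ, (∀ i < K, t i < y i ∧ y i < t (i + 1)) ∧
      Q = C Q.leadingCoeff * ∏ i ∈ range K, (X - C (y i)) := by
  have hroot : ∀ i, ∃ y, i < K → t i < y ∧ y < t (i + 1) ∧ Q.eval y = 0 := by
    intro i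
    by_cases hi : i < K
    · have hprod : Q.eval (t i) * Q.eval (t (i + 1)) < 0 := by
        have := mul_pos (hsign i hi.le) (hsign (i + 1) hi)
        have hone : (-1 : ℝ) ^ (i + K) * (-1) ^ (i + K) = 1 := by
          rw [← mul_pow]; norm_num
        rw [show i + 1 + K = i + K + 1 by ring, pow_succ] at this
        linear_combination this - Q.eval (t i) * Q.eval (t (i + 1)) * hone
      have hcont := Q.continuous.continuousOn (s := Set.Icc (t i) (t (i + 1)))
      rcases mul_neg_iff.mp hprod with ⟨h1, h2⟩ | ⟨h1, h2⟩
      · obtain ⟨y, hy, hy0⟩ := intermediate_value_Ioo' (ht i hi).le hcont ⟨h2, h1⟩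
        exact ⟨y, fun _ => ⟨hy.1, hy.2, hy0⟩⟩
      · obtain ⟨y, hy, hy0⟩ := intermediate_value_Ioo (ht i hi).le hcont ⟨h1, h2⟩
        exact ⟨y, fun _ => ⟨hy.1, hy.2, hy0⟩⟩
    · exact ⟨0, fun h => absurd h hi⟩
  choose y hy using hroot
  refine ⟨y, fun i hi => ⟨(hy i hi).1, (hy i hi).2.1⟩, ?_⟩
  have htmono : ∀ i j, i ≤ j → j ≤ K → t i ≤ t j := by
    intro i j hij
    induction j, hij using Nat.le_induction with
    | base => exact fun _ => le_rfl
    | succ j _ ih => exact fun hj => (ih (by lia)).trans (ht j hj).le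
  have hylt : ∀ i j, i < j → j < K → y i < y j := fun i j hij hj =>
    ((hy i (by lia)).2.1.trans_le (htmono (i + 1) j hij hj.le)).trans (hy j hj).1
  have hdvd : ∏ i ∈ range K, (X - C (y i)) ∣ Q := by
    refine prod_dvd_of_coprime (fun i hi j hj hij => ?_) fun j hj => ?_
    · refine isCoprime_X_sub_C_of_isUnit_sub (sub_ne_zero.mpr ?_).isUnit
      rw [mem_coe, mem_range] at hi hj
      rcases lt_or_gt_of_ne hij with h | h
      · exact (hylt i j h hj).ne
      · exact (hylt j i h hi).ne'
    · exact dvd_iff_isRoot.mpr (hy j (mem_range.mp hj)).2.2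
  refine eq_leadingCoeff_mul_of_monic_of_dvd_of_natDegree_le
    (monic_prod_of_monic _ _ fun _ _ => monic_X_sub_C _) hdvd ?_
  rwa [natDegree_prod_of_monic _ _ fun _ _ => monic_X_sub_C _, sum_congr rfl fun _ _ =>
    natDegree_X_sub_C _, sum_const, card_range, smul_eq_mul, mul_one]

end RealRoots

section FallingFactorialSum

open Polynomial

/-- The polynomial `∑ₛ b s * x^(s̲) * (x - s - 3/2)^((n-s)̲)`. -/
noncomputable def fallSumPoly (b : ℕ → ℝ) (n : ℕ) : ℝ[X] :=
  ∑ s ∈ range (n + 1), C (b s) * ((∏ i ∈ range s, (X - C (i : ℝ))) *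
    ∏ i ∈ range (n - s), (X - C (s + 3 / 2 + i : ℝ)))

lemma eval_fallSumPoly (b : ℕ → ℝ) (n : ℕ) (x : ℝ) :
    (fallSumPoly b n).eval x =
      ∑ s ∈ range (n + 1), b s * fallR x s * fallR (x - s - 3 / 2) (n - s) := by
  simp only [fallSumPoly, eval_finsetSum, eval_mul, eval_C, eval_prod, eval_sub, eval_X, fallR,
    mul_assoc, sub_sub, add_assoc]

lemma aeval_fallSumPoly (b : ℕ → ℝ) (n : ℕ) (z : ℂ) :
    aeval z (fallSumPoly b n) =
      ∑ s ∈ range (n + 1), (b s : ℂ) * fallC z s * fallC (z - s - 3 / 2) (n - s) := by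
  simp [fallSumPoly, fallC, mul_assoc, sub_sub, add_assoc]

lemma natDegree_coeff_fallSumPoly (b : ℕ → ℝ) (n : ℕ) :
    (fallSumPoly b n).natDegree ≤ n ∧ (fallSumPoly b n).coeff n = ∑ s ∈ range (n + 1), b s := by
  have hterm : ∀ s ∈ range (n + 1),
      ((∏ i ∈ range s, (X - C (i : ℝ))) * ∏ i ∈ range (n - s), (X - C (s + 3 / 2 + i : ℝ))).Monic ∧
      ((∏ i ∈ range s, (X - C (i : ℝ))) *
        ∏ i ∈ range (n - s), (X - C (s + 3 / 2 + i : ℝ))).natDegree = n := by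
    intro s hs
    have hs := mem_range.mp hs
    have h1 : (∏ i ∈ range s, (X - C (i : ℝ))).Monic :=
      monic_prod_of_monic _ _ fun _ _ => monic_X_sub_C _
    have h2 : (∏ i ∈ range (n - s), (X - C (s + 3 / 2 + i : ℝ))).Monic :=
      monic_prod_of_monic _ _ fun _ _ => monic_X_sub_C _
    refine ⟨h1.mul h2, ?_⟩
    rw [h1.natDegree_mul h2, natDegree_prod_of_monic _ _ fun _ _ => monic_X_sub_C _,
      natDegree_prod_of_monic _ _ fun _ _ => monic_X_sub_C _]
    simp only [natDegree_X_sub_C, sum_const, card_range, smul_eq_mul, mul_one]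
    lia
  constructor
  · exact natDegree_sum_le_of_forall_le _ _ fun s hs =>
      (natDegree_C_mul_le _ _).trans (hterm s hs).2.le
  · rw [fallSumPoly, finsetSum_coeff]
    refine sum_congr rfl fun s hs => ?_
    have h : _ = (1 : ℝ) := (hterm s hs).1.coeff_natDegree
    rw [(hterm s hs).2] at h
    rw [coeff_C_mul, h, mul_one]

variable {b : ℕ → ℝ}

lemma eval_fallSumPoly_natCast
    (hb : ∀ᶠ z : ℂ in nhds 0,
      HasSum (fun k : ℕ => (b k : ℂ) * z ^ k) ((1 + z + z ^ 2) ^ ((1 : ℂ) / 2)))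
    {m n : ℕ} (hmn : m ≤ n) :
    (fallSumPoly b n).eval (m : ℝ) = m.factorial * fallR (-3 / 2) (n - m) *
      if 3 ∣ m then oneSubPowCoeff (1 / 2) (m / 3) else 0 := by
  rw [eval_fallSumPoly, sum_fallR_natCast b hmn, sum_mul_oneSubPowCoeff hb]

lemma eval_fallSumPoly_succ_pos
    (hb : ∀ᶠ z : ℂ in nhds 0,
      HasSum (fun k : ℕ => (b k : ℂ) * z ^ k) ((1 + z + z ^ 2) ^ ((1 : ℂ) / 2))) (n : ℕ) :
    0 < (fallSumPoly b n).eval ((n + 1 : ℕ) : ℝ) := by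
  rw [eval_fallSumPoly, sum_fallR_natCast_succ, sum_mul_oneSubPowCoeff hb]
  exact mul_pos (by positivity) (sub_pos.mpr (dvd_three_coeff_lt hb n))

lemma exists_fallSumPoly_eq
    (hb : ∀ᶠ z : ℂ in nhds 0,
      HasSum (fun k : ℕ => (b k : ℂ) * z ^ k) ((1 + z + z ^ 2) ^ ((1 : ℂ) / 2))) (n : ℕ) :
    ∃ y : ℕ → ℝ, (∀ i < n / 3, 1 ≤ y i ∧ y i < n + 1) ∧
      fallSumPoly b n = C (fallSumPoly b n).leadingCoeff *
        (nonMultiplesPoly n * ∏ i ∈ range (n / 3), (X - C (y i))) := by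
  have hmonic : (nonMultiplesPoly n).Monic := monic_prod_of_monic _ _ fun _ _ => monic_X_sub_C _
  have hlast := eval_fallSumPoly_succ_pos hb n
  have hWlast : 0 < (nonMultiplesPoly n).eval ((n + 1 : ℕ) : ℝ) :=
    eval_nonMultiplesPoly_pos fun j hj _ => by exact_mod_cast Nat.lt_succ_of_le hj
  obtain ⟨Q, hQ⟩ : nonMultiplesPoly n ∣ fallSumPoly b n := nonMultiplesPoly_dvd fun j hj h3 => by
    rw [eval_fallSumPoly_natCast hb hj, if_neg h3, mul_zero]
  have hQ0 : Q ≠ 0 := by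
    rintro rfl
    simp [hQ] at hlast
  have hdeg : Q.natDegree ≤ n / 3 := by
    have h1 := (natDegree_coeff_fallSumPoly b n).1
    rw [hQ, hmonic.natDegree_mul' hQ0] at h1
    have := natDegree_nonMultiplesPoly n
    lia
  set t : ℕ → ℝ := fun i => if i < n / 3 then ((3 * (i + 1) : ℕ) : ℝ) else ((n + 1 : ℕ) : ℝ) with ht
  have htlt : ∀ i < n / 3, t i < t (i + 1) := by
    intro i hi
    simp only [ht, if_pos hi]
    split_ifs
    · exact_mod_cast by lia
    · exact_mod_cast by lia
  have htle : ∀ i, t i ≤ n + 1 := by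
    intro i
    simp only [ht]
    split_ifs
    · exact_mod_cast by lia
    · push_cast; rfl
  have hsign : ∀ i ≤ n / 3, 0 < (-1) ^ (i + n / 3) * Q.eval (t i) := by
    intro i hi
    rcases hi.lt_or_eq with hi | rfl
    · have hm : 3 * (i + 1) ≤ n := by lia
      simp only [ht, if_pos hi]
      have hP := eval_fallSumPoly_natCast hb hm
      have hW := neg_one_pow_mul_eval_nonMultiplesPoly_pos hm
      have hfall := neg_one_pow_mul_fallR_pos (n - 3 * (i + 1))
      have hfact : (0 : ℝ) < (3 * (i + 1)).factorial := by positivity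
      rw [if_pos (Nat.dvd_mul_right _ _), Nat.mul_div_cancel_left _ three_pos, hQ, eval_mul] at hP
      have hpar : (-1 : ℝ) ^ (i + n / 3) = -((-1) ^ (n - 3 * (i + 1)) * (-1) ^ (n % 3)) := by
        rw [← pow_add, ← neg_one_mul ((-1 : ℝ) ^ _), ← pow_succ']
        refine neg_one_pow_congr ?_
        rw [Nat.even_iff, Nat.even_iff]
        have : n - 3 * (i + 1) + n % 3 + 1 + 2 * (2 * i + 1) =
            i + n / 3 + 2 * (n / 3 + n % 3) := by lia
        omega
      have hone : (-1 : ℝ) ^ (n % 3) * (-1) ^ (n % 3) = 1 := by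
        rw [← mul_pow]; norm_num
      refine (mul_pos_iff_of_pos_left hW).mp ?_
      have hneg := mul_neg_of_pos_of_neg (mul_pos hfact hfall) (oneSubPowCoeff_half_neg i)
      rw [hpar]
      calc 0 < _ := neg_pos.mpr hneg
        _ = -((-1) ^ (n - 3 * (i + 1)) * ((nonMultiplesPoly n).eval ((3 * (i + 1) : ℕ) : ℝ) *
            Q.eval ((3 * (i + 1) : ℕ) : ℝ))) * ((-1 : ℝ) ^ (n % 3) * (-1) ^ (n % 3)) := by
          rw [hP, hone]; ring
        _ = _ := by ring
    · rw [hQ, eval_mul] at hlast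
      simp only [ht, lt_irrefl, if_false]
      rw [Even.neg_one_pow ⟨_, rfl⟩, one_mul]
      exact (mul_pos_iff_of_pos_left hWlast).mp hlast
  obtain ⟨y, hy, hQy⟩ := eq_prod_of_alternating hdeg htlt hsign
  refine ⟨y, fun i hi => ⟨?_, (hy i hi).2.trans_le (htle _)⟩, ?_⟩
  · refine le_trans ?_ (hy i hi).1.le
    simp only [ht, if_pos hi]
    exact_mod_cast by lia
  · have hlc : (fallSumPoly b n).leadingCoeff = Q.leadingCoeff := by
      rw [hQ, leadingCoeff_monic_mul hmonic]
    rw [hlc, mul_left_comm, ← hQy, hQ]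

lemma eval_factors_pos {n : ℕ} {y : ℕ → ℝ} (hy : ∀ i < n / 3, y i < n + 1) {x : ℝ}
    (hx : (n : ℝ) + 1 ≤ x) :
    0 < (nonMultiplesPoly n * ∏ i ∈ range (n / 3), (X - C (y i))).eval x := by
  rw [eval_mul, eval_prod]
  refine mul_pos (eval_nonMultiplesPoly_pos fun j hj _ => ?_) (prod_pos fun i hi => ?_)
  · have : (j : ℝ) ≤ n := by exact_mod_cast hj
    linarith
  · rw [eval_sub, eval_X, eval_C]
    linarith [hy i (mem_range.mp hi)]

lemma leadingCoeff_fallSumPoly_pos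
    (hb : ∀ᶠ z : ℂ in nhds 0,
      HasSum (fun k : ℕ => (b k : ℂ) * z ^ k) ((1 + z + z ^ 2) ^ ((1 : ℂ) / 2))) (n : ℕ) :
    0 < (fallSumPoly b n).leadingCoeff := by
  obtain ⟨y, hy, hfac⟩ := exists_fallSumPoly_eq hb n
  have hlast := eval_fallSumPoly_succ_pos hb n
  rw [hfac, eval_C_mul] at hlast
  exact (mul_pos_iff_of_pos_right
    (eval_factors_pos (fun i hi => (hy i hi).2) (by push_cast; rfl))).mp hlast

lemma eval_fallSumPoly_pos
    (hb : ∀ᶠ z : ℂ in nhds 0,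
      HasSum (fun k : ℕ => (b k : ℂ) * z ^ k) ((1 + z + z ^ 2) ^ ((1 : ℂ) / 2)))
    {n : ℕ} {x : ℝ} (hx : (n : ℝ) + 1 ≤ x) : 0 < (fallSumPoly b n).eval x := by
  obtain ⟨y, hy, hfac⟩ := exists_fallSumPoly_eq hb n
  rw [hfac, eval_C_mul]
  exact mul_pos (leadingCoeff_fallSumPoly_pos hb n)
    (eval_factors_pos (fun i hi => (hy i hi).2) hx)

lemma natDegree_fallSumPoly
    (hb : ∀ᶠ z : ℂ in nhds 0,
      HasSum (fun k : ℕ => (b k : ℂ) * z ^ k) ((1 + z + z ^ 2) ^ ((1 : ℂ) / 2))) (n : ℕ) :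
    (fallSumPoly b n).natDegree = n := by
  obtain ⟨y, -, hfac⟩ := exists_fallSumPoly_eq hb n
  have hmonic : (nonMultiplesPoly n).Monic := monic_prod_of_monic _ _ fun _ _ => monic_X_sub_C _
  rw [hfac, natDegree_C_mul (leadingCoeff_fallSumPoly_pos hb n).ne',
    hmonic.natDegree_mul (monic_prod_of_monic _ _ fun _ _ => monic_X_sub_C _),
    natDegree_prod_of_monic _ _ fun _ _ => monic_X_sub_C _]
  simpa using natDegree_nonMultiplesPoly n

lemma root_fallSumPoly
    (hb : ∀ᶠ z : ℂ in nhds 0,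
      HasSum (fun k : ℕ => (b k : ℂ) * z ^ k) ((1 + z + z ^ 2) ^ ((1 : ℂ) / 2)))
    {n : ℕ} {z : ℂ} (hz : aeval z (fallSumPoly b n) = 0) :
    ∃ x : ℝ, z = (x : ℂ) ∧ 1 ≤ x ∧ x < n + 1 := by
  obtain ⟨y, hy, hfac⟩ := exists_fallSumPoly_eq hb n
  rw [hfac, map_mul, map_mul, aeval_C, nonMultiplesPoly, map_prod, map_prod, mul_eq_zero,
    mul_eq_zero, prod_eq_zero_iff, prod_eq_zero_iff] at hz
  rcases hz with h | ⟨j, hj, h⟩ | ⟨i, hi, h⟩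
  · exact absurd ((map_eq_zero _).mp h) (leadingCoeff_fallSumPoly_pos hb n).ne'
  · rw [mem_filter, mem_Icc] at hj
    refine ⟨j, by simpa [sub_eq_zero] using h, by exact_mod_cast hj.1.1, ?_⟩
    exact_mod_cast Nat.lt_succ_of_le hj.1.2
  · exact ⟨y i, by simpa [sub_eq_zero] using h, hy i (mem_range.mp hi)⟩

end FallingFactorialSum

/-- Let `b_k` be the Taylor coefficients of the principal branch of
`√(1+z+z²)` and set `P(x) = ∑_{s=0}^n b_s · x^(s̲) · (x-s-3/2)^((n-s)̲)`. Then every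
complex root of `P` is real and lies in `[1, n+1)`; `P` has degree `n` with leading
coefficient `T_n(1) = ∑_{k=0}^n b_k > 0`; and consequently `P(x) > 0` for every real
`x ≥ n + 1`. -/
theorem roots_of_P
    (b : ℕ → ℝ)
    (hb : ∀ᶠ z : ℂ in nhds 0,
      HasSum (fun k : ℕ => (b k : ℂ) * z ^ k) ((1 + z + z ^ 2) ^ ((1 : ℂ) / 2)))
    (n : ℕ) :
    (∀ z : ℂ,
        (∑ s ∈ Finset.range (n + 1),
            (b s : ℂ) * fallC z s * fallC (z - s - 3 / 2) (n - s)) = 0 →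
        ∃ x : ℝ, z = (x : ℂ) ∧ 1 ≤ x ∧ x < n + 1) ∧
    (∃ p : Polynomial ℝ,
        (∀ x : ℝ, p.eval x =
          ∑ s ∈ Finset.range (n + 1), b s * fallR x s * fallR (x - s - 3 / 2) (n - s)) ∧
        p.degree = n ∧ p.leadingCoeff = ∑ k ∈ Finset.range (n + 1), b k ∧
        0 < p.leadingCoeff) ∧
    (∀ x : ℝ, (n : ℝ) + 1 ≤ x →
        0 < ∑ s ∈ Finset.range (n + 1), b s * fallR x s * fallR (x - s - 3 / 2) (n - s)) := by
  refine ⟨fun z hz => ?_, ⟨fallSumPoly b n, eval_fallSumPoly b n, ?_, ?_,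
    leadingCoeff_fallSumPoly_pos hb n⟩, fun x hx => ?_⟩
  · rw [← aeval_fallSumPoly] at hz
    exact root_fallSumPoly hb hz
  · rw [Polynomial.degree_eq_natDegree
      (Polynomial.leadingCoeff_ne_zero.mp (leadingCoeff_fallSumPoly_pos hb n).ne'),
      natDegree_fallSumPoly hb]
  · rw [Polynomial.leadingCoeff, natDegree_fallSumPoly hb, (natDegree_coeff_fallSumPoly b n).2]
  · rw [← eval_fallSumPoly]
    exact eval_fallSumPoly_pos hb hx
end

section
/- The series of squared Taylor coefficients of √(1+z+z²) converges with ∑_{k=0}^∞ b_k² = 1/3 + 2√3/π; equivalently, (1/2π) ∫_0^{2π} |1 + 2 cos t| dt = 1/3 + 2√3/π. -/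
open Finset

lemma integral_abs_one_add_two_cos :
    ∫ t in (0 : ℝ)..(2 * Real.pi), |1 + 2 * Real.cos t| =
      2 * Real.pi / 3 + 4 * Real.sqrt 3 := by
  have hpi := Real.pi_pos
  have hint : ∀ a b : ℝ, IntervalIntegrable (fun t => |1 + 2 * Real.cos t|)
      MeasureTheory.volume a b := fun a b =>
    Continuous.intervalIntegrable (by fun_prop) _ _
  have hprim : ∀ a b : ℝ, ∫ t in a..b, (1 + 2 * Real.cos t) =
      (b - a) + 2 * (Real.sin b - Real.sin a) := fun a b => by
    rw [intervalIntegral.integral_add (by simp)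
      (Continuous.intervalIntegrable (by fun_prop) _ _)]
    simp
  have hcos : Real.cos (2 * Real.pi / 3) = -(1 / 2) := by
    rw [show 2 * Real.pi / 3 = Real.pi - Real.pi / 3 by ring, Real.cos_pi_sub,
      Real.cos_pi_div_three]
  have hsin₁ : Real.sin (2 * Real.pi / 3) = Real.sqrt 3 / 2 := by
    rw [show 2 * Real.pi / 3 = Real.pi - Real.pi / 3 by ring, Real.sin_pi_sub,
      Real.sin_pi_div_three]
  have hsin₂ : Real.sin (4 * Real.pi / 3) = -(Real.sqrt 3 / 2) := by
    rw [show 4 * Real.pi / 3 = Real.pi / 3 + Real.pi by ring, Real.sin_add_pi,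
      Real.sin_pi_div_three]
  have hleft : ∀ t, 0 ≤ t → t ≤ 2 * Real.pi / 3 → -(1 / 2) ≤ Real.cos t := fun t h0 h1 => by
    rw [← hcos]
    exact Real.cos_le_cos_of_nonneg_of_le_pi h0 (by linarith) h1
  have hmid : ∀ t, 2 * Real.pi / 3 ≤ t → t ≤ Real.pi → Real.cos t ≤ -(1 / 2) :=
    fun t h0 h1 => by
      rw [← hcos]
      exact Real.cos_le_cos_of_nonneg_of_le_pi (by linarith) h1 h0
  have h₁ : ∫ t in (0 : ℝ)..(2 * Real.pi / 3), |1 + 2 * Real.cos t| =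
      ∫ t in (0 : ℝ)..(2 * Real.pi / 3), (1 + 2 * Real.cos t) := by
    refine intervalIntegral.integral_congr fun t ht => ?_
    rw [Set.uIcc_of_le (by linarith)] at ht
    exact abs_of_nonneg (by linarith [hleft t ht.1 ht.2])
  have h₂ : ∫ t in (2 * Real.pi / 3)..(4 * Real.pi / 3), |1 + 2 * Real.cos t| =
      ∫ t in (2 * Real.pi / 3)..(4 * Real.pi / 3), -(1 + 2 * Real.cos t) := by
    refine intervalIntegral.integral_congr fun t ht => ?_
    rw [Set.uIcc_of_le (by linarith)] at ht
    refine abs_of_nonpos ?_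
    rcases le_total t Real.pi with h | h
    · linarith [hmid t ht.1 h]
    · have := hmid (2 * Real.pi - t) (by linarith [ht.2]) (by linarith)
      rw [Real.cos_two_pi_sub] at this
      linarith
  have h₃ : ∫ t in (4 * Real.pi / 3)..(2 * Real.pi), |1 + 2 * Real.cos t| =
      ∫ t in (4 * Real.pi / 3)..(2 * Real.pi), (1 + 2 * Real.cos t) := by
    refine intervalIntegral.integral_congr fun t ht => ?_
    rw [Set.uIcc_of_le (by linarith)] at ht
    refine abs_of_nonneg ?_
    have := hleft (2 * Real.pi - t) (by linarith [ht.2]) (by linarith [ht.1])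
    rw [Real.cos_two_pi_sub] at this
    linarith
  rw [← intervalIntegral.integral_add_adjacent_intervals (hint 0 (2 * Real.pi / 3)) (hint _ _),
    ← intervalIntegral.integral_add_adjacent_intervals
      (hint (2 * Real.pi / 3) (4 * Real.pi / 3)) (hint _ _), h₁, h₂, h₃,
    intervalIntegral.integral_neg, hprim, hprim, hprim, hsin₁, hsin₂, Real.sin_zero,
    Real.sin_two_pi]
  ring

lemma integral_exp_int_mul_I (n : ℤ) :
    ∫ t in (0 : ℝ)..(2 * Real.pi), Complex.exp (n * t * Complex.I) =
      if n = 0 then 2 * (Real.pi : ℂ) else 0 := by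
  split_ifs with h
  · simp [h]
  · have hc : (n : ℂ) * Complex.I ≠ 0 := by simp [h]
    have := integral_exp_mul_complex (a := 0) (b := 2 * Real.pi) hc
    simp only [mul_right_comm _ Complex.I] at this
    rw [this]
    have h1 : Complex.exp (n * ((2 * Real.pi : ℝ) : ℂ) * Complex.I) = 1 := by
      rw [← Complex.exp_int_mul_two_pi_mul_I n]
      push_cast
      ring_nf
    rw [h1]
    simp

/-- The Fourier coefficients of an absolutely convergent one-sided trigonometric series. -/
lemma integral_tsum_mul_exp_neg {a : ℕ → ℂ} (ha : Summable fun k => ‖a k‖) (n : ℕ) :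
    ∫ t in (0 : ℝ)..(2 * Real.pi),
      (∑' k, a k * Complex.exp (k * t * Complex.I)) * Complex.exp (-(n * t * Complex.I)) =
      2 * Real.pi * a n := by
  have hsum : HasSum (fun k : ℕ => ∫ t in (0 : ℝ)..(2 * Real.pi),
      a k * Complex.exp (k * t * Complex.I) * Complex.exp (-(n * t * Complex.I)))
      (∫ t in (0 : ℝ)..(2 * Real.pi), (∑' k, a k * Complex.exp (k * t * Complex.I)) *
        Complex.exp (-(n * t * Complex.I))) := by
    refine intervalIntegral.hasSum_integral_of_dominated_convergence (fun k _ => ‖a k‖)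
      (fun k => (by fun_prop : Continuous _).aestronglyMeasurable) ?_ ?_ (by simp) ?_
    · refine fun k => .of_forall fun t _ => le_of_eq ?_
      simp [Complex.norm_exp]
    · exact .of_forall fun t _ => ha
    · refine .of_forall fun t _ => HasSum.mul_right _ (Summable.hasSum ?_)
      refine Summable.of_norm ?_
      simpa [Complex.norm_exp] using ha
  refine hsum.unique ?_
  have hterm : ∀ k : ℕ, ∫ t in (0 : ℝ)..(2 * Real.pi),
      a k * Complex.exp (k * t * Complex.I) * Complex.exp (-(n * t * Complex.I)) =
      if k = n then 2 * Real.pi * a n else 0 := fun k => by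
    have : ∀ t : ℝ, a k * Complex.exp (k * t * Complex.I) * Complex.exp (-(n * t * Complex.I)) =
        a k * Complex.exp (((k - n : ℤ) : ℂ) * t * Complex.I) := fun t => by
      rw [mul_assoc, ← Complex.exp_add]
      push_cast
      ring_nf
    simp only [this]
    rw [intervalIntegral.integral_const_mul, integral_exp_int_mul_I]
    by_cases hk : k = n
    · simp [hk, mul_comm]
    · have : (k : ℤ) - n ≠ 0 := by omega
      simp [hk, this]
  simp only [hterm]
  exact hasSum_ite_eq n _

/-- Parseval's identity for an absolutely convergent one-sided trigonometric series. -/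
lemma hasSum_norm_sq_of_summable_norm {a : ℕ → ℂ} (ha : Summable fun k => ‖a k‖) :
    HasSum (fun k => ‖a k‖ ^ 2) (1 / (2 * Real.pi) * ∫ t in (0 : ℝ)..(2 * Real.pi),
      ‖∑' k, a k * Complex.exp (k * t * Complex.I)‖ ^ 2) := by
  set F : ℝ → ℂ := fun t => ∑' k, a k * Complex.exp (k * t * Complex.I)
  have hnorm : ∀ (k : ℕ) (t : ℝ), ‖a k * Complex.exp (k * t * Complex.I)‖ = ‖a k‖ := fun k t => by
    simp [Complex.norm_exp]
  have hsumm : ∀ t : ℝ, Summable fun k : ℕ => a k * Complex.exp (k * t * Complex.I) := fun t =>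
    Summable.of_norm (by simpa only [hnorm] using ha)
  have hcont : Continuous F :=
    continuous_tsum (fun k => by fun_prop) ha fun k t => (hnorm k t).le
  have hbound : ∀ t, ‖F t‖ ≤ ∑' k, ‖a k‖ := fun t => by
    have := norm_tsum_le_tsum_norm (hsumm t).norm
    simpa only [hnorm] using this
  have hsum : HasSum (fun k : ℕ => ∫ t in (0 : ℝ)..(2 * Real.pi),
      F t * (starRingEnd ℂ) (a k * Complex.exp (k * t * Complex.I)))
      (∫ t in (0 : ℝ)..(2 * Real.pi), F t * (starRingEnd ℂ) (F t)) := by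
    refine intervalIntegral.hasSum_integral_of_dominated_convergence
      (fun k _ => (∑' j, ‖a j‖) * ‖a k‖)
      (fun k => (hcont.mul (Complex.continuous_conj.comp
        (by fun_prop))).aestronglyMeasurable) ?_ ?_ (by simp) ?_
    · refine fun k => .of_forall fun t _ => ?_
      rw [norm_mul, RCLike.norm_conj, hnorm]
      gcongr
      exact hbound t
    · exact .of_forall fun t _ => ha.mul_left _
    · exact .of_forall fun t _ => ((Complex.hasSum_conj'.mpr
        (by simpa using (hsumm t).hasSum))).mul_left _
  have hterm : ∀ k : ℕ, ∫ t in (0 : ℝ)..(2 * Real.pi),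
      F t * (starRingEnd ℂ) (a k * Complex.exp (k * t * Complex.I)) =
      ((2 * Real.pi * ‖a k‖ ^ 2 : ℝ) : ℂ) := fun k => by
    have : ∀ t : ℝ, F t * (starRingEnd ℂ) (a k * Complex.exp (k * t * Complex.I)) =
        (starRingEnd ℂ) (a k) * (F t * Complex.exp (-(k * t * Complex.I))) := fun t => by
      rw [map_mul, ← Complex.exp_conj]
      simp only [map_mul, Complex.conj_I, Complex.conj_ofReal, map_natCast, mul_neg]
      ring
    simp only [this]
    rw [intervalIntegral.integral_const_mul, integral_tsum_mul_exp_neg ha, mul_left_comm,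
      Complex.conj_mul']
    push_cast
    ring
  have hsq : ∫ t in (0 : ℝ)..(2 * Real.pi), F t * (starRingEnd ℂ) (F t) =
      ((∫ t in (0 : ℝ)..(2 * Real.pi), ‖F t‖ ^ 2 : ℝ) : ℂ) := by
    rw [← intervalIntegral.integral_ofReal]
    simp [Complex.mul_conj']
  simp only [hterm] at hsum
  rw [hsq, Complex.hasSum_ofReal] at hsum
  have hscale : ∀ k, 1 / (2 * Real.pi) * (2 * Real.pi * ‖a k‖ ^ 2) = ‖a k‖ ^ 2 := fun k => by
    field_simp
  simpa only [hscale] using hsum.mul_left (1 / (2 * Real.pi))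

lemma one_add_self_add_sq_mem_slitPlane {z : ℂ} (hz : ‖z‖ < 1) :
    1 + z + z ^ 2 ∈ Complex.slitPlane := by
  have h : z.re ^ 2 + z.im ^ 2 < 1 := by
    have := Complex.sq_norm z
    rw [Complex.normSq_apply] at this
    nlinarith [norm_nonneg z]
  rw [Complex.mem_slitPlane_iff]
  by_contra! hc
  obtain ⟨hre, him⟩ := hc
  simp [pow_two] at hre him
  have : z.im * (1 + 2 * z.re) = 0 := by linarith
  rcases mul_eq_zero.mp this with h0 | h0
  · rw [h0] at hre
    nlinarith [sq_nonneg (z.re + 1 / 2)]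
  · have : z.re = -1 / 2 := by linarith
    rw [this] at hre h
    nlinarith

/-- A power series representing near `0` a function holomorphic on the unit disc represents it on
the whole disc. -/
lemma hasSum_of_eventually_hasSum_of_differentiableOn {f : ℂ → ℂ} {c : ℕ → ℂ}
    (hf : DifferentiableOn ℂ f (Metric.ball 0 1))
    (hc : ∀ᶠ z in nhds 0, HasSum (fun k => c k * z ^ k) (f z)) {z : ℂ} (hz : ‖z‖ < 1) :
    HasSum (fun k => c k * z ^ k) (f z) := by
  obtain ⟨r, hzr, hr1⟩ := exists_between hz
  have hr0 : 0 < r := (norm_nonneg z).trans_lt hzr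
  lift r to NNReal using hr0.le
  have hball := (hf.mono (Metric.closedBall_subset_ball hr1)).hasFPowerSeriesOnBall
    (by exact_mod_cast hr0)
  have hat : HasFPowerSeriesAt f (FormalMultilinearSeries.ofScalars ℂ c) 0 := by
    rw [hasFPowerSeriesAt_iff]
    filter_upwards [hc] with w hw
    simpa [FormalMultilinearSeries.coeff_ofScalars, mul_comm] using hw
  rw [← hat.eq_formalMultilinearSeries hball.hasFPowerSeriesAt] at hball
  have := hball.hasSum (y := z) (by simpa using hzr)
  simpa [FormalMultilinearSeries.ofScalars_apply_eq, mul_comm] using this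

/-- A form of Abel's theorem for nonnegative terms: if the power series with coefficients `a`
tends to a limit at `1` from the left, then `a` sums to this limit. -/
lemma hasSum_of_tendsto_of_nonneg {a : ℕ → ℝ} (ha : ∀ k, 0 ≤ a k) {g : ℝ → ℝ} {L : ℝ}
    (hg : Filter.Tendsto g (nhdsWithin 1 (Set.Iio 1)) (nhds L))
    (h : ∀ r, 0 < r → r < 1 → HasSum (fun k => a k * r ^ k) (g r)) : HasSum a L := by
  have hev : ∀ᶠ r : ℝ in nhdsWithin 1 (Set.Iio 1), 0 < r ∧ r < 1 :=
    Ioo_mem_nhdsLT one_pos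
  have hpow : ∀ k : ℕ, Filter.Tendsto (fun r : ℝ => a k * r ^ k)
      (nhdsWithin 1 (Set.Iio 1)) (nhds (a k)) := fun k => by
    have : Continuous fun r : ℝ => a k * r ^ k := by fun_prop
    simpa using (this.tendsto 1).mono_left nhdsWithin_le_nhds
  have hs : Summable a := by
    refine summable_of_sum_range_le (c := L) ha fun n => ?_
    refine le_of_tendsto_of_tendsto (tendsto_finsetSum _ fun k _ => hpow k) hg ?_
    filter_upwards [hev] with r hr
    exact sum_le_hasSum _ (fun k _ => mul_nonneg (ha k) (pow_nonneg hr.1.le k)) (h r hr.1 hr.2)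
  have hlim := tendsto_tsum_of_dominated_convergence hs hpow (by
    filter_upwards [hev] with r hr k
    rw [norm_mul, norm_pow, Real.norm_of_nonneg (ha k), Real.norm_of_nonneg hr.1.le]
    exact mul_le_of_le_one_right (ha k) (pow_le_one₀ hr.1.le hr.2.le))
  have : Filter.Tendsto g (nhdsWithin 1 (Set.Iio 1)) (nhds (∑' k, a k)) := by
    refine hlim.congr' ?_
    filter_upwards [hev] with r hr using (h r hr.1 hr.2).tsum_eq
  rw [tendsto_nhds_unique hg this]
  exact hs.hasSum

/-- Let `b_k` be the Taylor coefficients of the principal branch of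
`√(1+z+z²)`. Then `∑_{k=0}^∞ b_k² = 1/3 + 2√3/π`; equivalently,
`(1/2π) ∫_0^{2π} |1 + 2 cos t| dt = 1/3 + 2√3/π`. -/
theorem sum_sq_coeff_eq
    (b : ℕ → ℝ)
    (hb : ∀ᶠ z : ℂ in nhds 0,
      HasSum (fun k : ℕ => (b k : ℂ) * z ^ k) ((1 + z + z ^ 2) ^ ((1 : ℂ) / 2))) :
    HasSum (fun k : ℕ => (b k) ^ 2) (1 / 3 + 2 * Real.sqrt 3 / Real.pi) ∧
    (1 / (2 * Real.pi)) * ∫ t in (0 : ℝ)..(2 * Real.pi), |1 + 2 * Real.cos t| =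
      1 / 3 + 2 * Real.sqrt 3 / Real.pi := by
  have hval : (1 / (2 * Real.pi)) * ∫ t in (0 : ℝ)..(2 * Real.pi), |1 + 2 * Real.cos t| =
      1 / 3 + 2 * Real.sqrt 3 / Real.pi := by
    rw [integral_abs_one_add_two_cos]
    field_simp
    ring
  refine ⟨?_, hval⟩
  rw [← hval]
  have hdiff : DifferentiableOn ℂ (fun z : ℂ => (1 + z + z ^ 2) ^ ((1 : ℂ) / 2))
      (Metric.ball 0 1) := fun z hz =>
    (DifferentiableAt.cpow (f := fun z : ℂ => 1 + z + z ^ 2) (by fun_prop) (by fun_prop)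
      (one_add_self_add_sq_mem_slitPlane (by simpa using hz))).differentiableWithinAt
  have hsum : ∀ z : ℂ, ‖z‖ < 1 →
      HasSum (fun k : ℕ => (b k : ℂ) * z ^ k) ((1 + z + z ^ 2) ^ ((1 : ℂ) / 2)) := fun z hz =>
    hasSum_of_eventually_hasSum_of_differentiableOn hdiff hb hz
  have hsqrt : ∀ w : ℂ, ‖w ^ ((1 : ℂ) / 2)‖ ^ 2 = ‖w‖ := fun w => by
    rw [← norm_pow, ← Complex.cpow_nat_mul]
    simp
  set p : ℝ → ℝ → ℂ := fun r t =>
    1 + r * Complex.exp (t * Complex.I) + (r * Complex.exp (t * Complex.I)) ^ 2 with hp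
  set g : ℝ → ℝ := fun s => 1 / (2 * Real.pi) *
    ∫ t in (0 : ℝ)..(2 * Real.pi), ‖p (Real.sqrt s) t‖ with hg
  have hgcont : Continuous g := by
    refine continuous_const.mul
      (intervalIntegral.continuous_parametric_intervalIntegral_of_continuous' ?_ _ _)
    simp only [hp, Function.uncurry_def]
    fun_prop
  have hg1 : g 1 = 1 / (2 * Real.pi) *
      ∫ t in (0 : ℝ)..(2 * Real.pi), |1 + 2 * Real.cos t| := by
    have : ∀ t : ℝ, ‖p 1 t‖ = |1 + 2 * Real.cos t| := fun t => by
      have hfac : p 1 t = Complex.exp (t * Complex.I) * ((1 + 2 * Real.cos t : ℝ) : ℂ) := by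
        simp only [hp]
        push_cast
        rw [Complex.two_cos, neg_mul, Complex.exp_neg]
        field_simp
        ring
      rw [hfac, norm_mul, Complex.norm_exp_ofReal_mul_I, one_mul, Complex.norm_real,
        Real.norm_eq_abs]
    simp only [hg, Real.sqrt_one, this]
  rw [← hg1]
  refine hasSum_of_tendsto_of_nonneg (fun k => sq_nonneg (b k))
    ((hgcont.tendsto 1).mono_left nhdsWithin_le_nhds) fun s hs0 hs1 => ?_
  set r := Real.sqrt s with hr
  have hr0 : 0 ≤ r := Real.sqrt_nonneg s
  have hr1 : r < 1 := by rwa [hr, Real.sqrt_lt' one_pos, one_pow]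
  have hsumm : Summable fun k : ℕ => ‖(b k : ℂ) * (r : ℂ) ^ k‖ :=
    (hsum r (by simpa [abs_of_nonneg hr0] using hr1)).summable.norm
  have hcircle : ∀ t : ℝ, ∑' k : ℕ, (b k : ℂ) * (r : ℂ) ^ k * Complex.exp (k * t * Complex.I) =
      p r t ^ ((1 : ℂ) / 2) := fun t => by
    rw [← (hsum (r * Complex.exp (t * Complex.I)) (by
      simpa [Complex.norm_exp, abs_of_nonneg hr0] using hr1)).tsum_eq]
    refine tsum_congr fun k => ?_
    rw [mul_pow, ← Complex.exp_nat_mul]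
    ring_nf
  have hpars := hasSum_norm_sq_of_summable_norm hsumm
  simp only [hcircle, hsqrt] at hpars
  convert hpars using 2 with k
  rw [norm_mul, norm_pow, Complex.norm_real, Complex.norm_real, mul_pow, ← pow_mul, mul_comm k 2,
    pow_mul, Real.norm_of_nonneg hr0, Real.sq_sqrt hs0.le, Real.norm_eq_abs, sq_abs]
end
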